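/- Let q ≥ 1 and 2 ≤ t ≤ 2^q be integers and let d = 7·2^q − 2t. For any 2^{q+1} − 2 masses μ_1, …, μ_{2^{q+1}−2} on ℝ^d there exist four pairwise orthogonal hyperplanes H_1, H_2, H_3, H_4 in ℝ^d such that (i) any three of H_1, H_2, H_3, H_4 equipartition each of the first 2^{q+1} − t masses μ_1, …, μ_{2^{q+1}−t}, and (ii) any two of H_2, H_3, H_4 equipartition each of the remaining t − 2 masses μ_{2^{q+1}−t+1}, …, μ_{2^{q+1}−2}. -/

import Mathlib

open MeasureTheory RealInnerProductSpace

noncomputable section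

/-- The closed half-space determined by the hyperplane `{x | ⟪a, x⟫ = b}`:
`true` corresponds to `H⁺ = {x | ⟪a, x⟫ ≥ b}`, `false` to `H⁻ = {x | ⟪a, x⟫ ≤ b}`. -/
def halfSpace {d : ℕ} (a : EuclideanSpace ℝ (Fin d)) (b : ℝ) (ε : Bool) :
    Set (EuclideanSpace ℝ (Fin d)) :=
  if ε then {x | b ≤ ⟪a, x⟫} else {x | ⟪a, x⟫ ≤ b}

/-- The region `⋂ i ∈ s, H i ^ (ε i)` determined by the hyperplanes indexed by `s`. -/
def region {d k : ℕ} (a : Fin k → EuclideanSpace ℝ (Fin d)) (b : Fin k → ℝ)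
    (s : Finset (Fin k)) (ε : Fin k → Bool) : Set (EuclideanSpace ℝ (Fin d)) :=
  ⋂ i ∈ s, halfSpace (a i) (b i) (ε i)

namespace Equi

/-- Integer grid points. -/
abbrev Grid (N : ℕ) := Fin N → ℤ

/-- The vertices of a simplex of the triangulation. -/
def path {N : ℕ} (v w : Grid N) (π : Equiv.Perm (Fin N)) (k : ℕ) : Grid N :=
  fun j => if (π.symm j : ℕ) < k then w j else v j

open Classical in
/-- The top-dimensional simplices of the triangulated cube `[-M, M]^N`. -/
def spx (N : ℕ) (M : ℤ) : Finset (Grid N × Grid N × Equiv.Perm (Fin N)) :=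
  ((Fintype.piFinset (fun _ => Finset.Icc (-M) M)) ×ˢ
    (Fintype.piFinset (fun _ => Finset.Icc (-M) M)) ×ˢ Finset.univ).filter
    (fun p => ∀ j, Even (p.1 j) ∧ |p.2.1 j - p.1 j| = 1)

lemma mem_spx {N : ℕ} {M : ℤ} {p : Grid N × Grid N × Equiv.Perm (Fin N)} :
    p ∈ spx N M ↔ ∀ j, |p.1 j| ≤ M ∧ |p.2.1 j| ≤ M ∧ Even (p.1 j) ∧ |p.2.1 j - p.1 j| = 1 := by
  simp only [spx, Finset.mem_filter, Finset.mem_product, Fintype.mem_piFinset, Finset.mem_Icc,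
    Finset.mem_univ, and_true, abs_le]
  constructor
  · rintro ⟨⟨h1, h2⟩, h3⟩ j
    exact ⟨h1 j, h2 j, h3 j⟩
  · intro h
    exact ⟨⟨fun j => (h j).1, fun j => (h j).2.1⟩, fun j => (h j).2.2⟩

lemma sum_indep {N : ℕ} {M : ℤ} (hM : Even M) {j : ℕ} (hj : j < N)
    (F : (ℕ → Grid N) → ZMod 2)
    (hF : ∀ u u' : ℕ → Grid N, (∀ k, k ≠ j → u k = u' k) → F u = F u') :
    ∑ p ∈ spx N M, F (path p.1 p.2.1 p.2.2) = 0 := by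
  rcases Nat.eq_zero_or_pos j with rfl | hpos
  · -- change the first vertex
    let z : Fin N := ⟨0, hj⟩
    refine Finset.sum_involution
      (fun p _ => (Function.update p.1 (p.2.2 z) (2 * p.2.1 (p.2.2 z) - p.1 (p.2.2 z)), p.2.1, p.2.2))
      ?_ ?_ ?_ ?_
    · rintro ⟨v, w, π⟩ hp
      rw [hF (path v w π) (path (Function.update v (π z) (2 * w (π z) - v (π z))) w π)]
      · exact CharTwo.add_self_eq_zero _
      · intro k hk
        funext i
        simp only [path]
        by_cases hi : i = π z
        · subst hi
          have : ((π.symm (π z) : Fin N) : ℕ) < k := by simp [z]; omega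
          simp only [this, if_true]
        · simp [Function.update_of_ne hi]
    · rintro ⟨v, w, π⟩ hp - h
      have h1 := congrFun (congrArg Prod.fst h) (π z)
      have h2 := (mem_spx.1 hp (π z)).2.2.2
      simp at h1 h2
      have : w (π z) - v (π z) = 0 := by linarith
      rw [this] at h2; simp at h2
    · rintro ⟨v, w, π⟩ hp
      rw [mem_spx] at hp ⊢
      intro i
      by_cases hi : i = π z
      · subst hi
        obtain ⟨h1, h2, h3, h4⟩ := hp (π z)
        simp only [Function.update_self] at *
        obtain ⟨c, hc⟩ := h3
        obtain ⟨e, he⟩ := hM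
        rw [abs_le] at h1 h2
        rcases (abs_eq (by norm_num)).1 h4 with h4 | h4
        · refine ⟨abs_le.2 ⟨by omega, by omega⟩, abs_le.2 h2, ⟨c + 1, by omega⟩, ?_⟩
          rw [show w (π z) - (2 * w (π z) - v (π z)) = -1 by omega]; rfl
        · refine ⟨abs_le.2 ⟨by omega, by omega⟩, abs_le.2 h2, ⟨c - 1, by omega⟩, ?_⟩
          rw [show w (π z) - (2 * w (π z) - v (π z)) = 1 by omega]; rfl
      · simpa [Function.update_of_ne hi] using hp i
    · rintro ⟨v, w, π⟩ hp
      simp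
  · -- swap two consecutive steps
    let x : Fin N := ⟨j - 1, by omega⟩
    let y : Fin N := ⟨j, hj⟩
    have hxy : x ≠ y := by simp [x, y, Fin.ext_iff]; omega
    refine Finset.sum_involution
      (fun p _ => (p.1, p.2.1, (Equiv.swap x y).trans p.2.2)) ?_ ?_ ?_ ?_
    · rintro ⟨v, w, π⟩ hp
      rw [hF (path v w π) (path v w ((Equiv.swap x y).trans π))]
      · exact CharTwo.add_self_eq_zero _
      · intro k hk
        funext i
        simp only [path, Equiv.symm_trans_apply, Equiv.symm_swap]
        have : ((π.symm i : Fin N) : ℕ) < k ↔ ((Equiv.swap x y (π.symm i) : Fin N) : ℕ) < k := by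
          rw [Equiv.swap_apply_def]
          split_ifs with h1 h2
          · rw [h1]; simp only [x, y]; omega
          · rw [h2]; simp only [x, y]; omega
          · rfl
        exact if_congr this rfl rfl
    · rintro ⟨v, w, π⟩ hp - h
      have h1 := congrArg (fun p => p.2.2 x) h
      simp at h1
      exact hxy h1.symm
    · rintro ⟨v, w, π⟩ hp
      rw [mem_spx] at hp ⊢
      exact hp
    · rintro ⟨v, w, π⟩ hp
      simp only [Prod.mk.injEq, true_and]
      ext i
      simp

/-- Negate the coordinates in block `i`. -/
def flip {N r : ℕ} (blk : Fin N → Fin r) (i : Fin r) (v : Grid N) : Grid N :=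
  fun j => if blk j = i then - v j else v j

/-- `v` lies on the boundary of the `i`-th block cube. -/
def Bd {N r : ℕ} (blk : Fin N → Fin r) (M : ℤ) (i : Fin r) (v : Grid N) : Prop :=
  ∃ j, blk j = i ∧ |v j| = M

lemma flip_flip {N r : ℕ} (blk : Fin N → Fin r) (i : Fin r) (v : Grid N) :
    flip blk i (flip blk i v) = v := by
  funext j; simp only [flip]; split_ifs <;> simp

lemma abs_flip {N r : ℕ} (blk : Fin N → Fin r) (i : Fin r) (v : Grid N) (j : Fin N) :
    |flip blk i v j| = |v j| := by
  simp only [flip]; split_ifs <;> simp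

lemma flip_path {N r : ℕ} (blk : Fin N → Fin r) (i : Fin r) (v w : Grid N)
    (π : Equiv.Perm (Fin N)) (k : ℕ) :
    path (flip blk i v) (flip blk i w) π k = flip blk i (path v w π k) := by
  funext j; simp only [flip, path]; split_ifs <;> rfl

lemma sum_bdry {N r : ℕ} (hN : 0 < N) (blk : Fin N → Fin r) {M : ℤ} (hM0 : 0 < M) 
    (F : (ℕ → Grid N) → ZMod 2)
    (hF : ∀ u u' : ℕ → Grid N, (∀ k, k < N → u k = u' k) → F u = F u')
    (hsym : ∀ (u : ℕ → Grid N) (i : Fin r), (∀ k j, |u k j| ≤ M) →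
      (∀ k, k < N → Bd blk M i (u k)) → F (fun k => flip blk i (u k)) = F u) :
    ∑ p ∈ spx N M, F (path p.1 p.2.1 p.2.2) = 0 := by
  classical
  let z : Fin N := ⟨N - 1, by omega⟩
  rw [← Finset.sum_filter_add_sum_filter_not _ (fun p => |p.1 (p.2.2 z)| < M)]
  have hA : ∑ p ∈ (spx N M).filter (fun p => |p.1 (p.2.2 z)| < M),
      F (path p.1 p.2.1 p.2.2) = 0 := by
    refine Finset.sum_involution
      (fun p _ => (p.1, Function.update p.2.1 (p.2.2 z) (2 * p.1 (p.2.2 z) - p.2.1 (p.2.2 z)),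
        p.2.2)) ?_ ?_ ?_ ?_
    · rintro ⟨v, w, π⟩ hp
      rw [hF (path v w π) (path v (Function.update w (π z) (2 * v (π z) - w (π z))) π)]
      · exact CharTwo.add_self_eq_zero _
      · intro k hk
        funext i
        simp only [path]
        by_cases hi : i = π z
        · subst hi
          have : ¬ ((π.symm (π z) : Fin N) : ℕ) < k := by simp [z]; omega
          simp only [this, if_false]
        · simp [Function.update_of_ne hi]
    · rintro ⟨v, w, π⟩ hp - h
      have h1 := congrFun (congrArg (fun p => p.2.1) h) (π z)
      have h2 := (mem_spx.1 (Finset.mem_filter.1 hp).1 (π z)).2.2.2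
      simp at h1 h2
      have : w (π z) - v (π z) = 0 := by linarith
      rw [this] at h2; simp at h2
    · rintro ⟨v, w, π⟩ hp
      rw [Finset.mem_filter, mem_spx] at hp ⊢
      obtain ⟨hp, hlt⟩ := hp
      refine ⟨fun i => ?_, hlt⟩
      by_cases hi : i = π z
      · subst hi
        obtain ⟨h1, h2, h3, h4⟩ := hp (π z)
        simp only [Function.update_self] at *
        rw [abs_lt] at hlt
        rw [abs_le] at h1 h2
        rcases (abs_eq (by norm_num)).1 h4 with h4 | h4
        · refine ⟨abs_le.2 h1, abs_le.2 ⟨by omega, by omega⟩, h3, ?_⟩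
          rw [show 2 * v (π z) - w (π z) - v (π z) = -1 by omega]; rfl
        · refine ⟨abs_le.2 h1, abs_le.2 ⟨by omega, by omega⟩, h3, ?_⟩
          rw [show 2 * v (π z) - w (π z) - v (π z) = 1 by omega]; rfl
      · simpa [Function.update_of_ne hi] using hp i
    · rintro ⟨v, w, π⟩ hp
      simp
  have hB : ∑ p ∈ (spx N M).filter (fun p => ¬ |p.1 (p.2.2 z)| < M),
      F (path p.1 p.2.1 p.2.2) = 0 := by
    refine Finset.sum_involution
      (fun p _ => (flip blk (blk (p.2.2 z)) p.1, flip blk (blk (p.2.2 z)) p.2.1, p.2.2)) ?_ ?_ ?_ ?_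
    · rintro ⟨v, w, π⟩ hp
      rw [Finset.mem_filter, mem_spx] at hp
      obtain ⟨hp, hlt⟩ := hp
      have := hsym (path v w π) (blk (π z)) ?_ ?_
      · simp only
        rw [show path (flip blk (blk (π z)) v) (flip blk (blk (π z)) w) π = 
          (fun k => flip blk (blk (π z)) (path v w π k)) from funext fun k => flip_path _ _ _ _ _ _]
        rw [this]
        exact CharTwo.add_self_eq_zero _
      · intro k j
        simp only [path]
        split_ifs
        · exact (hp j).2.1
        · exact (hp j).1
      · intro k hk
        refine ⟨π z, rfl, ?_⟩
        have : ¬ ((π.symm (π z) : Fin N) : ℕ) < k := by simp [z]; omega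
        simp only [path, this, if_false]
        exact le_antisymm (hp _).1 (not_lt.1 hlt)
    · rintro ⟨v, w, π⟩ hp - h
      rw [Finset.mem_filter] at hp
      have h1 := congrFun (congrArg Prod.fst h) (π z)
      simp [flip] at h1
      have h2 := hp.2
      simp at h2
      have : v (π z) = 0 := by omega
      rw [this] at h2; simp at h2; omega
    · rintro ⟨v, w, π⟩ hp
      rw [Finset.mem_filter, mem_spx] at hp ⊢
      obtain ⟨hp, hlt⟩ := hp
      refine ⟨fun i => ?_, ?_⟩
      · obtain ⟨h1, h2, h3, h4⟩ := hp i
        refine ⟨by simpa [abs_flip] using h1, by simpa [abs_flip] using h2, ?_, ?_⟩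
        · simp only [flip]; split_ifs
          · exact h3.neg
          · exact h3
        · simp only [flip]; split_ifs
          · rw [← h4, ← abs_neg]; congr 1; simp only; ring
          · exact h4
      · simpa [abs_flip] using hlt
    · rintro ⟨v, w, π⟩ hp
      simp [flip_flip]
  rw [hA, hB, add_zero]

end Equi

namespace Equi

/-- `β` has type `A`. -/
def Typed {N r : ℕ} (blk : Fin N → Fin r) (M : ℤ) (A : Finset (Fin r)) (β : Grid N → ZMod 2) :
    Prop :=
  ∀ (i : Fin r) (v : Grid N), (∀ j, |v j| ≤ M) → Bd blk M i v →
    β (flip blk i v) = β v + if i ∈ A then 1 else 0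

/-- The evaluation of the cup product of the cochains `δ (β k)` on the cube. -/
def cup (N : ℕ) (M : ℤ) (β : ℕ → Grid N → ZMod 2) : ZMod 2 :=
  ∑ p ∈ spx N M, ∏ k ∈ Finset.range N,
    (β k (path p.1 p.2.1 p.2.2 k) + β k (path p.1 p.2.1 p.2.2 (k + 1)))

section shift
variable {N : ℕ} (β : ℕ → Grid N → ZMod 2) (γ : Grid N → ZMod 2) (l : ℕ)

/-- Left shifts. -/
def XX (p : ℕ) (u : ℕ → Grid N) : ZMod 2 :=
  (∏ k ∈ Finset.range p, (β k (u k) + β k (u (k + 1)))) *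
  (∏ k ∈ Finset.Ico p l, (β k (u (k + 1)) + β k (u (k + 2)))) * γ (u (l + 1)) *
  ∏ k ∈ Finset.Ico (l + 1) N, (β k (u k) + β k (u (k + 1)))

/-- Right shifts. -/
def YY (p : ℕ) (u : ℕ → Grid N) : ZMod 2 :=
  (∏ k ∈ Finset.range l, (β k (u k) + β k (u (k + 1)))) * γ (u l) *
  (∏ k ∈ Finset.Ico (l + 1) p, (β k (u (k - 1)) + β k (u k))) *
  ∏ k ∈ Finset.Ico p N, (β k (u k) + β k (u (k + 1)))

lemma XX_step {M : ℤ} (hM : Even M) (hl : l < N) {p : ℕ} (hp : p < l) :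
    ∑ s ∈ spx N M, XX β γ l (p + 1) (path s.1 s.2.1 s.2.2) =
    ∑ s ∈ spx N M, XX β γ l p (path s.1 s.2.1 s.2.2) := by
  rw [← sub_eq_zero, ← Finset.sum_sub_distrib]
  have key : ∀ u : ℕ → Grid N, XX β γ l (p + 1) u - XX β γ l p u =
    (∏ k ∈ Finset.range p, (β k (u k) + β k (u (k + 1)))) * (β p (u p) + β p (u (p + 2))) *
    (∏ k ∈ Finset.Ico (p + 1) l, (β k (u (k + 1)) + β k (u (k + 2)))) * γ (u (l + 1)) *
      ∏ k ∈ Finset.Ico (l + 1) N, (β k (u k) + β k (u (k + 1))) := by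
    intro u
    have h2 : β p (u (p + 1)) + β p (u (p + 1)) = 0 := CharTwo.add_self_eq_zero _
    simp only [XX]
    rw [Finset.prod_range_succ, Finset.prod_eq_prod_Ico_succ_bot hp, CharTwo.sub_eq_add]
    linear_combination ((∏ k ∈ Finset.range p, (β k (u k) + β k (u (k + 1)))) *
      (∏ k ∈ Finset.Ico (p + 1) l, (β k (u (k + 1)) + β k (u (k + 2)))) * γ (u (l + 1)) *
      ∏ k ∈ Finset.Ico (l + 1) N, (β k (u k) + β k (u (k + 1)))) * h2
  refine sum_indep hM (j := p + 1) (by omega) (fun u => XX β γ l (p + 1) u - XX β γ l p u) ?_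
  intro u u' h
  simp only [key]
  congr 1
  · congr 1
    · congr 1
      · congr 1
        · refine Finset.prod_congr rfl fun k hk => ?_
          rw [Finset.mem_range] at hk
          rw [h k (by omega), h (k + 1) (by omega)]
        · rw [h p (by omega), h (p + 2) (by omega)]
      · refine Finset.prod_congr rfl fun k hk => ?_
        rw [Finset.mem_Ico] at hk
        rw [h (k + 1) (by omega), h (k + 2) (by omega)]
    · rw [h (l + 1) (by omega)]
  · refine Finset.prod_congr rfl fun k hk => ?_
    rw [Finset.mem_Ico] at hk
    rw [h k (by omega), h (k + 1) (by omega)]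

lemma XX_zero {M : ℤ} (hM : Even M) (hl : l < N) {p : ℕ} (hp : p ≤ l) :
    ∑ s ∈ spx N M, XX β γ l p (path s.1 s.2.1 s.2.2) = 0 := by
  induction p with
  | zero =>
    refine sum_indep hM (j := 0) (by omega) (fun u => XX β γ l 0 u) ?_
    intro u u' h
    simp only [XX]
    congr 1
    · congr 1
      · congr 1
        refine Finset.prod_congr rfl fun k hk => ?_
        rw [h (k + 1) (by omega), h (k + 2) (by omega)]
      · rw [h (l + 1) (by omega)]
    · refine Finset.prod_congr rfl fun k hk => ?_
      rw [Finset.mem_Ico] at hk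
      rw [h k (by omega), h (k + 1) (by omega)]
  | succ p ih => rw [XX_step β γ l hM hl (by omega), ih (by omega)]

lemma YY_step {M : ℤ} (hM : Even M) {p : ℕ} (hlp : l < p) (hp : p < N) :
    ∑ s ∈ spx N M, YY β γ l p (path s.1 s.2.1 s.2.2) =
    ∑ s ∈ spx N M, YY β γ l (p + 1) (path s.1 s.2.1 s.2.2) := by
  rw [← sub_eq_zero, ← Finset.sum_sub_distrib]
  have key : ∀ u : ℕ → Grid N, YY β γ l p u - YY β γ l (p + 1) u =
    (∏ k ∈ Finset.range l, (β k (u k) + β k (u (k + 1)))) * γ (u l) *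
    (∏ k ∈ Finset.Ico (l + 1) p, (β k (u (k - 1)) + β k (u k))) *
    (β p (u (p - 1)) + β p (u (p + 1))) *
      ∏ k ∈ Finset.Ico (p + 1) N, (β k (u k) + β k (u (k + 1))) := by
    intro u
    have h2 : β p (u p) + β p (u p) = 0 := CharTwo.add_self_eq_zero _
    simp only [YY]
    rw [Finset.prod_Ico_succ_top (by omega), Finset.prod_eq_prod_Ico_succ_bot hp,
      CharTwo.sub_eq_add]
    linear_combination ((∏ k ∈ Finset.range l, (β k (u k) + β k (u (k + 1)))) * γ (u l) *
      (∏ k ∈ Finset.Ico (l + 1) p, (β k (u (k - 1)) + β k (u k))) *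
      ∏ k ∈ Finset.Ico (p + 1) N, (β k (u k) + β k (u (k + 1)))) * h2
  refine sum_indep hM (j := p) (by omega) (fun u => YY β γ l p u - YY β γ l (p + 1) u) ?_
  intro u u' h
  simp only [key]
  congr 1
  · congr 1
    · congr 1
      · congr 1
        · refine Finset.prod_congr rfl fun k hk => ?_
          rw [Finset.mem_range] at hk
          rw [h k (by omega), h (k + 1) (by omega)]
        · rw [h l (by omega)]
      · refine Finset.prod_congr rfl fun k hk => ?_
        rw [Finset.mem_Ico] at hk
        rw [h (k - 1) (by omega), h k (by omega)]
    · rw [h (p - 1) (by omega), h (p + 1) (by omega)]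
  · refine Finset.prod_congr rfl fun k hk => ?_
    rw [Finset.mem_Ico] at hk
    rw [h k (by omega), h (k + 1) (by omega)]

lemma YY_top {r : ℕ} (blk : Fin N → Fin r) {M : ℤ} (hM0 : 0 < M) (hl : l < N)
    (A : ℕ → Finset (Fin r)) (hβ : ∀ k, k ≠ l → Typed blk M (A k) (β k))
    (hγ : Typed blk M ∅ γ) :
    ∑ s ∈ spx N M, YY β γ l N (path s.1 s.2.1 s.2.2) = 0 := by
  refine sum_bdry (by omega) blk hM0 (fun u => YY β γ l N u) ?_ ?_
  · intro u u' h
    simp only [YY]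
    congr 1
    · congr 1
      · congr 1
        · refine Finset.prod_congr rfl fun k hk => ?_
          rw [Finset.mem_range] at hk
          rw [h k (by omega), h (k + 1) (by omega)]
        · rw [h l (by omega)]
      · refine Finset.prod_congr rfl fun k hk => ?_
        rw [Finset.mem_Ico] at hk
        rw [h (k - 1) (by omega), h k (by omega)]
    · simp
  · intro u i hb hbd
    have hsum : ∀ k, k ≠ l → ∀ a b, a < N → b < N →
        β k (flip blk i (u a)) + β k (flip blk i (u b)) = β k (u a) + β k (u b) := by
      intro k hk a b ha hb'
      rw [hβ k hk i _ (hb a) (hbd a ha), hβ k hk i _ (hb b) (hbd b hb')]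
      have : ((if i ∈ A k then 1 else 0 : ZMod 2)) + (if i ∈ A k then 1 else 0 : ZMod 2) = 0 :=
        CharTwo.add_self_eq_zero _
      linear_combination this
    simp only [YY]
    congr 1
    · congr 1
      · congr 1
        · refine Finset.prod_congr rfl fun k hk => ?_
          rw [Finset.mem_range] at hk
          exact hsum k (by omega) _ _ (by omega) (by omega)
        · rw [hγ i _ (hb l) (hbd l hl)]; simp
      · refine Finset.prod_congr rfl fun k hk => ?_
        rw [Finset.mem_Ico] at hk
        exact hsum k (by omega) _ _ (by omega) (by omega)
    · simp

lemma YY_zero {r : ℕ} (blk : Fin N → Fin r) {M : ℤ} (hM : Even M) (hM0 : 0 < M) (hl : l < N)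
    (A : ℕ → Finset (Fin r)) (hβ : ∀ k, k ≠ l → Typed blk M (A k) (β k))
    (hγ : Typed blk M ∅ γ) (n : ℕ) : ∀ p, l < p → p + n = N →
    ∑ s ∈ spx N M, YY β γ l p (path s.1 s.2.1 s.2.2) = 0 := by
  induction n with
  | zero => intro p hp h; obtain rfl : p = N := by omega
            exact YY_top β γ l blk hM0 hl A hβ hγ
  | succ n ih => intro p hp h; rw [YY_step β γ l hM hp (by omega)]; exact ih _ (by omega) (by omega)

end shift

lemma cup_update {N r : ℕ} (blk : Fin N → Fin r) {M : ℤ} (hM : Even M) (hM0 : 0 < M)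
    (A : ℕ → Finset (Fin r)) (β : ℕ → Grid N → ZMod 2) (l : ℕ) (hl : l < N) (γ : Grid N → ZMod 2)
    (hβ : ∀ k, Typed blk M (A k) (β k)) (hγ : Typed blk M (A l) γ) :
    cup N M (Function.update β l γ) = cup N M β := by
  have hty : Typed blk M ∅ (fun v => β l v + γ v) := by
    intro i v hv hb
    simp only [hβ l i v hv hb, hγ i v hv hb]
    have : ((if i ∈ A l then 1 else 0 : ZMod 2)) + (if i ∈ A l then 1 else 0 : ZMod 2) = 0 :=
        CharTwo.add_self_eq_zero _
    simp only [Finset.notMem_empty, if_false]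
    linear_combination this
  have h1 := XX_zero β (fun v => β l v + γ v) l hM hl le_rfl
  have h2 := YY_zero β (fun v => β l v + γ v) l blk hM hM0 hl A (fun k _ => hβ k) hty (N - (l + 1))
    (l + 1) (by omega) (by omega)
  rw [← sub_eq_zero]
  simp only [cup]
  rw [← Finset.sum_sub_distrib, ← add_zero (0 : ZMod 2)]
  nth_rewrite 1 [← h1]
  nth_rewrite 1 [← h2]
  rw [← Finset.sum_add_distrib]
  refine Finset.sum_congr rfl fun s _ => ?_
  generalize path s.1 s.2.1 s.2.2 = u
  rw [← Finset.prod_range_mul_prod_Ico _ hl.le, ← Finset.prod_range_mul_prod_Ico _ hl.le,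
    Finset.prod_eq_prod_Ico_succ_bot hl, Finset.prod_eq_prod_Ico_succ_bot hl]
  have e1 : ∏ k ∈ Finset.range l, (Function.update β l γ k (u k) + Function.update β l γ k (u (k + 1)))
      = ∏ k ∈ Finset.range l, (β k (u k) + β k (u (k + 1))) := by
    refine Finset.prod_congr rfl fun k hk => ?_
    rw [Finset.mem_range] at hk
    rw [Function.update_of_ne (by omega)]
  have e2 : ∏ k ∈ Finset.Ico (l + 1) N, (Function.update β l γ k (u k) + Function.update β l γ k (u (k + 1)))
      = ∏ k ∈ Finset.Ico (l + 1) N, (β k (u k) + β k (u (k + 1))) := by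
    refine Finset.prod_congr rfl fun k hk => ?_
    rw [Finset.mem_Ico] at hk
    rw [Function.update_of_ne (by omega)]
  rw [e1, e2, Function.update_self, CharTwo.sub_eq_add]
  simp only [XX, YY, Finset.Ico_self, Finset.prod_empty]
  ring

lemma cup_congr {N r : ℕ} (blk : Fin N → Fin r) {M : ℤ} (hM : Even M) (hM0 : 0 < M)
    (A : ℕ → Finset (Fin r)) (β β' : ℕ → Grid N → ZMod 2) 
    (hβ : ∀ k, Typed blk M (A k) (β k)) (hβ' : ∀ k, Typed blk M (A k) (β' k)) :
    cup N M β = cup N M β' := by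
  have key : ∀ p ≤ N, cup N M (fun k => if k < p then β' k else β k) = cup N M β := by
    intro p
    induction p with
    | zero => intro _; simp
    | succ p ih =>
      intro hp
      rw [← ih (by omega), ← cup_update blk hM hM0 A (fun k => if k < p then β' k else β k) p
        (by omega) (β' p) _ (hβ' p)]
      · congr 1
        funext k
        by_cases h : k = p
        · subst h; simp
        · rw [Function.update_of_ne h]
          have : k < p + 1 ↔ k < p := by omega
          simp only [this]
      · intro k
        split_ifs
        · exact hβ' k
        · exact hβ k
  rw [← key N le_rfl]
  simp only [cup]
  refine Finset.sum_congr rfl fun s _ => Finset.prod_congr rfl fun k hk => ?_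
  rw [Finset.mem_range] at hk
  simp [hk]

end Equi

namespace Equi

/-- Version of `cup` with `Fin`-indexed cochains. -/
def cupF (N : ℕ) (M : ℤ) (β : Fin N → Grid N → ZMod 2) : ZMod 2 :=
  ∑ p ∈ spx N M, ∏ k : Fin N,
    (β k (path p.1 p.2.1 p.2.2 k) + β k (path p.1 p.2.1 p.2.2 (k + 1)))

lemma cupF_congr {N r : ℕ} (blk : Fin N → Fin r) {M : ℤ} (hM : Even M) (hM0 : 0 < M)
    (A : Fin N → Finset (Fin r)) (β β' : Fin N → Grid N → ZMod 2)
    (hβ : ∀ k, Typed blk M (A k) (β k)) (hβ' : ∀ k, Typed blk M (A k) (β' k)) :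
    cupF N M β = cupF N M β' := by
  have e : ∀ β : Fin N → Grid N → ZMod 2,
      cupF N M β = cup N M (fun k => if h : k < N then β ⟨k, h⟩ else 0) := by
    intro β
    simp only [cupF, cup]
    refine Finset.sum_congr rfl fun s _ => ?_
    rw [Finset.prod_range]
    refine Finset.prod_congr rfl fun k _ => ?_
    simp
  have ht : ∀ β : Fin N → Grid N → ZMod 2, (∀ k, Typed blk M (A k) (β k)) → ∀ k : ℕ,
      Typed blk M (if h : k < N then A ⟨k, h⟩ else ∅) (if h : k < N then β ⟨k, h⟩ else 0) := by
    intro β hβ k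
    by_cases h : k < N
    · simpa [h] using hβ ⟨k, h⟩
    · simp only [h, dite_false]
      intro i v _ _
      simp
  rw [e, e]
  exact cup_congr blk hM hM0 (fun k => if h : k < N then A ⟨k, h⟩ else ∅) _ _ (ht β hβ) (ht β' hβ')

/-- Block `i` of the vector `v`. -/
def blkPart {N r : ℕ} (blk : Fin N → Fin r) (i : Fin r) (v : Grid N) : Lex (Grid N) :=
  toLex (fun j => if blk j = i then v j else 0)

open Classical in
/-- Boundary sign bit. -/
def tau {N r : ℕ} (blk : Fin N → Fin r) (M : ℤ) (i : Fin r) (v : Grid N) : ZMod 2 :=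
  if Bd blk M i v then (if 0 < blkPart blk i v then 1 else 0) else 0

open Classical in
/-- Sign bit of a coordinate. -/
def bit {N r : ℕ} (blk : Fin N → Fin r) (M : ℤ) (j : Fin N) (v : Grid N) : ZMod 2 :=
  if v j = 0 then tau blk M (blk j) v else if 0 < v j then 1 else 0

lemma Bd_flip {N r : ℕ} (blk : Fin N → Fin r) (M : ℤ) (i i' : Fin r) (v : Grid N) :
    Bd blk M i (flip blk i' v) ↔ Bd blk M i v := by
  simp only [Bd, abs_flip]

lemma tau_flip_ne {N r : ℕ} (blk : Fin N → Fin r) (M : ℤ) {i i' : Fin r} (h : i' ≠ i) (v : Grid N) :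
    tau blk M i (flip blk i' v) = tau blk M i v := by
  have : blkPart blk i (flip blk i' v) = blkPart blk i v := by
    simp only [blkPart, flip]
    congr 1
    funext j
    split_ifs with h1 h2
    · exact absurd (h2.symm.trans h1) h
    · rfl
    · rfl
  unfold tau
  rw [this, propext (Bd_flip blk M i i' v)]

lemma tau_flip {N r : ℕ} (blk : Fin N → Fin r) {M : ℤ} (hM0 : 0 < M) {i : Fin r} (v : Grid N)
    (hb : Bd blk M i v) : tau blk M i (flip blk i v) = tau blk M i v + 1 := by
  have h1 : blkPart blk i (flip blk i v) = - blkPart blk i v := by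
    apply ofLex.injective
    funext j
    simp only [blkPart, flip, ofLex_toLex, ofLex_neg, Pi.neg_apply]
    split_ifs <;> simp
  have h2 : blkPart blk i v ≠ 0 := by
    obtain ⟨j, hj, hv⟩ := hb
    intro h
    have := congrFun (congrArg ofLex h) j
    have h0 : v j = 0 := by
      simp only [blkPart, ofLex_toLex, if_pos hj] at this
      exact this
    rw [h0, abs_zero] at hv; omega
  unfold tau
  rw [h1, propext (Bd_flip blk M i i v), if_pos hb, if_pos hb]
  rcases lt_or_gt_of_ne h2 with h | h
  · have e1 : 0 < - blkPart blk i v := neg_pos.2 h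
    have e2 : ¬ 0 < blkPart blk i v := not_lt.2 h.le
    simp only [e1, e2, if_true, if_false]; rfl
  · have e1 : ¬ (0 < - blkPart blk i v) := not_lt.2 (neg_nonpos.2 h.le)
    have e2 : 0 < blkPart blk i v := h
    simp only [e1, e2, if_true, if_false]; rfl

lemma typed_tau {N r : ℕ} (blk : Fin N → Fin r) {M : ℤ} (hM0 : 0 < M) (i : Fin r) :
    Typed blk M {i} (tau blk M i) := by
  intro i' v _ hb
  by_cases h : i' = i
  · subst h
    simp [tau_flip blk hM0 v hb]
  · simp [tau_flip_ne blk M h, h]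

lemma typed_bit {N r : ℕ} (blk : Fin N → Fin r) {M : ℤ} (hM0 : 0 < M) (j : Fin N) :
    Typed blk M {blk j} (bit blk M j) := by
  intro i v hv hb
  have ht := typed_tau blk hM0 (blk j) i v hv hb
  simp only [bit]
  by_cases h : v j = 0
  · have : flip blk i v j = 0 := by simp [flip, h]
    rw [if_pos h, if_pos this, ht]
  · by_cases hi : i = blk j
    · subst hi
      simp only [flip, if_true, Finset.mem_singleton, neg_eq_zero, if_neg h]
      rcases lt_or_gt_of_ne h with h | h
      · rw [if_pos (by omega), if_neg (by omega)]; rfl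
      · rw [if_neg (by omega), if_pos (by omega)]; rfl
    · have : flip blk i v j = v j := by simp [flip, Ne.symm hi]
      simp [this, h, hi]

lemma typed_sum_tau {N r : ℕ} (blk : Fin N → Fin r) {M : ℤ} (hM0 : 0 < M) (A : Finset (Fin r)) :
    Typed blk M A (fun v => ∑ i ∈ A, tau blk M i v) := by
  intro i v hv hb
  simp only [typed_tau blk hM0 _ i v hv hb, Finset.sum_add_distrib, Finset.mem_singleton,
    Finset.sum_ite_eq]

lemma path_close {N : ℕ} {M : ℤ} {p : Grid N × Grid N × Equiv.Perm (Fin N)} (_hp : p ∈ spx N M)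
    (k : ℕ) (j : Fin N) : path p.1 p.2.1 p.2.2 k j = p.1 j ∨ path p.1 p.2.1 p.2.2 k j = p.2.1 j := by
  simp only [path]; split_ifs <;> simp

lemma bit_change {N r : ℕ} (blk : Fin N → Fin r) {M : ℤ}
    {p : Grid N × Grid N × Equiv.Perm (Fin N)} (hp : p ∈ spx N M)
    (k l : ℕ) (j : Fin N)
    (h : bit blk M j (path p.1 p.2.1 p.2.2 k) + bit blk M j (path p.1 p.2.1 p.2.2 l) ≠ 0) :
    p.1 j = 0 := by
  obtain ⟨-, -, ⟨c, hc⟩, h4⟩ := mem_spx.1 hp j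
  by_contra h0
  have hw : p.2.1 j ≠ 0 := by
    intro h
    rcases (abs_eq (by norm_num)).1 h4 with h4 | h4 <;> omega
  have hsame : 0 < p.1 j ↔ 0 < p.2.1 j := by
    rcases (abs_eq (by norm_num)).1 h4 with h4 | h4 <;> omega
  apply h
  have hb : ∀ k, bit blk M j (path p.1 p.2.1 p.2.2 k) = if 0 < p.1 j then 1 else 0 := by
    intro k
    simp only [bit]
    rcases path_close hp k j with h | h <;> rw [h]
    · rw [if_neg h0]
    · rw [if_neg hw]; simp only [hsame]
  rw [hb, hb]
  exact CharTwo.add_self_eq_zero _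

lemma tau_small {N r : ℕ} (blk : Fin N → Fin r) {M : ℤ} (hM2 : 2 ≤ M)
    {p : Grid N × Grid N × Equiv.Perm (Fin N)} (hp : p ∈ spx N M) (i : Fin r)
    (h : ∀ j, blk j = i → p.1 j = 0) (k : ℕ) : tau blk M i (path p.1 p.2.1 p.2.2 k) = 0 := by
  have : ¬ Bd blk M i (path p.1 p.2.1 p.2.2 k) := by
    rintro ⟨j, hj, hv⟩
    have h0 := h j hj
    obtain ⟨-, -, -, h4⟩ := mem_spx.1 hp j
    rcases path_close hp k j with h | h <;> rw [h] at hv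
    · rw [h0] at hv; simp at hv; omega
    · rw [h0, sub_zero] at h4; omega
  simp [tau, this]

lemma cupF_bit {N r : ℕ} (blk : Fin N → Fin r) {M : ℤ} (hM2 : 2 ≤ M)
    (ρ : Equiv.Perm (Fin N)) : cupF N M (fun k => bit blk M (ρ k)) = 1 := by
  have hmem : ((fun _ => 0, fun _ => 1, ρ) : Grid N × Grid N × Equiv.Perm (Fin N)) ∈ spx N M := by
    rw [mem_spx]
    intro j
    simp
    omega
  have hbit : ∀ p ∈ spx N M, (∀ j, p.1 j = 0) → ∀ k j,
      bit blk M j (path p.1 p.2.1 p.2.2 k) = if 0 < path p.1 p.2.1 p.2.2 k j then 1 else 0 := by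
    intro p hp h k j
    simp only [bit]
    split_ifs with h1 h2
    · omega
    · exact tau_small blk hM2 hp _ (fun j _ => h j) k
    · rfl
    · rfl
  rw [cupF, Finset.sum_eq_single_of_mem _ hmem]
  · refine Finset.prod_eq_one fun k _ => ?_
    rw [hbit _ hmem (fun _ => rfl), hbit _ hmem (fun _ => rfl)]
    simp [path]
  · rintro ⟨v, w, π⟩ hp hne
    by_contra hprod
    apply hne
    have hk : ∀ k : Fin N, _ := fun k => Finset.prod_ne_zero_iff.1 hprod k (Finset.mem_univ k)
    have hv : ∀ j, v j = 0 := by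
      intro j
      have := hk (ρ.symm j)
      simp only [Equiv.apply_symm_apply] at this
      exact bit_change blk hp _ _ j this
    have hw : ∀ k : Fin N, w (ρ k) = 1 ∧ π.symm (ρ k) = k := by
      intro k
      have h := hk k
      rw [hbit _ hp hv, hbit _ hp hv] at h
      have hvv : ∀ (k' : ℕ), path v w π k' (ρ k) =
          if (π.symm (ρ k) : ℕ) < k' then w (ρ k) else 0 := by
        intro k'; simp only [path, hv]
      simp only [hvv] at h
      have h4 := (mem_spx.1 hp (ρ k)).2.2.2
      simp only [hv, sub_zero] at h4
      have hcase : ∀ x : ℤ, ((if (0:ℤ) < x then 1 else 0 : ZMod 2) + (if (0:ℤ) < x then 1 else 0)) = 0 :=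
        fun x => CharTwo.add_self_eq_zero _
      by_cases h1 : (π.symm (ρ k) : ℕ) < k
      · have h2 : (π.symm (ρ k) : ℕ) < k + 1 := by omega
        simp only [h1, h2, if_true] at h
        exact absurd (hcase (w (ρ k))) h
      · by_cases h2 : (π.symm (ρ k) : ℕ) < k + 1
        · simp only [h1, h2, if_true, if_false] at h
          refine ⟨?_, Fin.ext (by omega)⟩
          rcases (abs_eq (by norm_num)).1 h4 with h4 | h4
          · exact h4
          · rw [h4] at h; simp at h
        · simp only [h1, h2, if_false] at h
          exact absurd (hcase 0) h
    have e1 : v = fun _ => 0 := funext hv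
    have e2 : w = fun _ => 1 := by
      funext j
      simpa using (hw (ρ.symm j)).1
    have e3 : π = ρ := by
      ext k
      congr 1
      exact ((Equiv.symm_apply_eq _).1 (hw k).2).symm
    rw [e1, e2, e3]

lemma cupF_tau {N r : ℕ} (blk : Fin N → Fin r) {M : ℤ} (hM : Even M) (hM2 : 2 ≤ M)
    (σ : Fin N → Fin r) : cupF N M (fun k => tau blk M (σ k)) =
      if (∀ i, Fintype.card {k // σ k = i} = Fintype.card {j // blk j = i}) then 1 else 0 := by
  have hM0 : 0 < M := by omega
  split_ifs with h
  · have e : ∀ i, Nonempty ({k // σ k = i} ≃ {j // blk j = i}) := fun i => Fintype.card_eq.1 (h i)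
    let e := fun i => (e i).some
    let ρ : Equiv.Perm (Fin N) := (Equiv.sigmaFiberEquiv σ).symm.trans
      ((Equiv.sigmaCongrRight (fun i => e i)).trans (Equiv.sigmaFiberEquiv blk))
    have hρ : ∀ k, blk (ρ k) = σ k := by
      intro k
      exact (e (σ k) ⟨k, rfl⟩).2
    rw [← cupF_bit blk hM2 ρ]
    refine cupF_congr blk hM hM0 (fun k => {σ k}) _ _ (fun k => typed_tau blk hM0 _) (fun k => ?_)
    rw [← hρ]; exact typed_bit blk hM0 _
  · -- some block is used too often
    have hlt : ∃ i, Fintype.card {j // blk j = i} < Fintype.card {k // σ k = i} := by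
      by_contra! hle
      apply h
      have h1 : ∑ i, Fintype.card {k // σ k = i} = ∑ i, Fintype.card {j // blk j = i} := by
        rw [← Fintype.card_sigma, ← Fintype.card_sigma, Fintype.card_congr (Equiv.sigmaFiberEquiv σ),
          Fintype.card_congr (Equiv.sigmaFiberEquiv blk)]
      intro i
      exact (Finset.sum_eq_sum_iff_of_le (fun i _ => hle i)).1 h1 i (Finset.mem_univ i)
    obtain ⟨i, hi⟩ := hlt
    obtain ⟨e⟩ := Function.Embedding.nonempty_of_card_le hi.le
    obtain ⟨⟨k0, hk0⟩, hk0'⟩ : ∃ y, ∀ x, e x ≠ y := by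
      by_contra! hs
      exact absurd (Fintype.card_le_of_surjective e hs) (not_le.2 hi)
    classical
    let β : Fin N → Grid N → ZMod 2 := fun k =>
      if hx : ∃ x, (e x).1 = k then bit blk M hx.choose.1 else tau blk M (σ k)
    have hβ : ∀ k, Typed blk M {σ k} (β k) := by
      intro k
      simp only [β]
      split_ifs with hx
      · have h1 : σ k = i := by rw [← hx.choose_spec]; exact (e _).2
        have h2 := hx.choose.2
        have h3 := typed_bit blk hM0 hx.choose.1
        rw [h1]
        rwa [show ({blk hx.choose.1} : Finset (Fin r)) = {i} from by rw [h2]] at h3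
      · exact typed_tau blk hM0 _
    rw [cupF_congr blk hM hM0 (fun k => {σ k}) _ β (fun k => typed_tau blk hM0 _) hβ]
    refine Finset.sum_eq_zero fun p hp => ?_
    by_contra hprod
    have hk : ∀ k : Fin N, _ := fun k => Finset.prod_ne_zero_iff.1 hprod k (Finset.mem_univ k)
    have hv : ∀ j, blk j = i → p.1 j = 0 := by
      intro j hj
      have h1 := hk (e ⟨j, hj⟩).1
      have hx : ∃ x, (e x).1 = (e ⟨j, hj⟩).1 := ⟨_, rfl⟩
      have h2 : hx.choose = ⟨j, hj⟩ := e.injective (Subtype.ext hx.choose_spec)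
      have h3 : β (e ⟨j, hj⟩).1 = bit blk M j := by
        simp only [β, dif_pos hx, h2]
      rw [h3] at h1
      exact bit_change blk hp _ _ j h1
    have h1 := hk k0
    have h3 : β k0 = tau blk M i := by
      simp only [β]
      rw [dif_neg, hk0]
      rintro ⟨x, hx⟩
      exact hk0' x (Subtype.ext hx)
    rw [h3, tau_small blk hM2 hp i hv, tau_small blk hM2 hp i hv] at h1
    simp at h1

theorem cupF_eq_count {N r : ℕ} (blk : Fin N → Fin r) {M : ℤ} (hM : Even M) (hM2 : 2 ≤ M)
    (A : Fin N → Finset (Fin r)) (β : Fin N → Grid N → ZMod 2)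
    (hβ : ∀ k, Typed blk M (A k) (β k)) :
    cupF N M β = ∑ σ ∈ Fintype.piFinset A,
      if (∀ i, Fintype.card {k // σ k = i} = Fintype.card {j // blk j = i}) then 1 else 0 := by
  have hM0 : 0 < M := by omega
  rw [cupF_congr blk hM hM0 A β (fun k v => ∑ i ∈ A k, tau blk M i v) hβ
    (fun k => typed_sum_tau blk hM0 _)]
  simp only [← cupF_tau blk hM hM2]
  simp only [cupF]
  rw [Finset.sum_comm]
  refine Finset.sum_congr rfl fun p _ => ?_
  simp only [← Finset.sum_add_distrib]
  rw [Finset.prod_univ_sum]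

end Equi

namespace Equi

/-- Flip of a block of a real vector. -/
def rflip {ι : Type*} {r : ℕ} (blk : ι → Fin r) (i : Fin r) (x : ι → ℝ) : ι → ℝ :=
  fun j => if blk j = i then - x j else x j

open Classical in
/-- The labelling cochain. -/
def lab {N r : ℕ} (blk : Fin N → Fin r) (M : ℤ) (A : Finset (Fin r)) (f : (Fin N → ℝ) → ℝ)
    (v : Grid N) : ZMod 2 :=
  if f (fun j => (v j : ℝ) / M) = 0 then ∑ i ∈ A, tau blk M i v
  else if 0 < f (fun j => (v j : ℝ) / M) then 1 else 0

lemma typed_lab {N r : ℕ} (blk : Fin N → Fin r) {M : ℤ} (hM0 : 0 < M) (A : Finset (Fin r))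
    (f : (Fin N → ℝ) → ℝ)
    (hflip : ∀ i x, (∀ j, |x j| ≤ 1) → (∃ j, blk j = i ∧ |x j| = 1) →
      f (rflip blk i x) = (if i ∈ A then -1 else 1) * f x) :
    Typed blk M A (lab blk M A f) := by
  intro i v hv hb
  have hMr : (0 : ℝ) < M := by exact_mod_cast hM0
  have e : (fun j => ((flip blk i v j : ℤ) : ℝ) / M) = rflip blk i (fun j => (v j : ℝ) / M) := by
    funext j
    simp only [flip, rflip]
    split_ifs
    · push_cast; ring
    · rfl
  have habs : ∀ j, |((v j : ℤ) : ℝ) / M| = ((|v j| : ℤ) : ℝ) / M := by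
    intro j; rw [abs_div, abs_of_pos hMr]; push_cast; rfl
  have h := hflip i (fun j => (v j : ℝ) / M) (by
    intro j
    rw [habs, div_le_one hMr]
    exact_mod_cast hv j) (by
    obtain ⟨j, hj, h⟩ := hb
    refine ⟨j, hj, ?_⟩
    rw [habs, h, div_self hMr.ne'])
  have ht := typed_sum_tau blk hM0 A i v hv hb
  simp only [lab]
  rw [e]
  by_cases h0 : f (fun j => (v j : ℝ) / M) = 0
  · rw [h0, mul_zero] at h
    rw [if_pos h, if_pos h0]
    exact ht
  · by_cases hi : i ∈ A
    · simp only [hi, if_true] at h ⊢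
      rw [h]
      rcases lt_or_gt_of_ne h0 with h1 | h1
      · rw [if_neg (by linarith), if_pos (by linarith), if_neg h0, if_neg (by linarith)]; rfl
      · rw [if_neg (by linarith), if_neg (by linarith), if_neg h0, if_pos h1]; rfl
    · simp only [hi, if_false, one_mul, add_zero] at h ⊢
      rw [h, if_neg h0, if_neg h0]

lemma exists_approx {N r : ℕ} (blk : Fin N → Fin r) (A : Fin N → Finset (Fin r))
    (f : Fin N → (Fin N → ℝ) → ℝ)
    (hflip : ∀ k i x, (∀ j, |x j| ≤ 1) → (∃ j, blk j = i ∧ |x j| = 1) →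
      f k (rflip blk i x) = (if i ∈ A k then -1 else 1) * f k x)
    (hcount : (∑ σ ∈ Fintype.piFinset A,
      if (∀ i, Fintype.card {k // σ k = i} = Fintype.card {j // blk j = i}) then 1 else 0 : ZMod 2)
      ≠ 0) (m : ℕ) :
    ∃ (x : Fin N → ℝ) (y z : Fin N → Fin N → ℝ), (∀ j, |x j| ≤ 1) ∧
      (∀ k j, |y k j - x j| ≤ 1 / ((m : ℝ) + 1)) ∧ (∀ k j, |z k j - x j| ≤ 1 / ((m : ℝ) + 1)) ∧
      ∀ k, f k (y k) * f k (z k) ≤ 0 := by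
  set M : ℤ := 2 * (m + 1) with hMdef
  have hM0 : 0 < M := by omega
  have hMr : (0 : ℝ) < M := by exact_mod_cast hM0
  have h := cupF_eq_count blk (M := M) ⟨m + 1, by omega⟩ (by omega) A
    (fun k => lab blk M (A k) (f k)) (fun k => typed_lab blk hM0 _ _ (hflip k))
  rw [← h] at hcount
  obtain ⟨p, hp, hne⟩ := Finset.exists_ne_zero_of_sum_ne_zero hcount
  have hk : ∀ k : Fin N, _ := fun k => Finset.prod_ne_zero_iff.1 hne k (Finset.mem_univ k)
  have hclose : ∀ k j, |((path p.1 p.2.1 p.2.2 k j : ℤ) : ℝ) / M - (p.1 j : ℝ) / M| ≤ 1 / ((m : ℝ) + 1) := by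
    intro k j
    rw [← sub_div, abs_div, abs_of_pos hMr]
    have h4 := (mem_spx.1 hp j).2.2.2
    have h5 : |((path p.1 p.2.1 p.2.2 k j : ℤ) : ℝ) - (p.1 j : ℝ)| ≤ 1 := by
      rcases path_close hp k j with h | h <;> rw [h]
      · simp
      · have : |((p.2.1 j - p.1 j : ℤ) : ℝ)| = 1 := by rw [← Int.cast_abs, h4]; simp
        push_cast at this
        exact this.le
    refine div_le_div₀ zero_le_one h5 (by positivity) ?_
    rw [hMdef]; push_cast; linarith [(Nat.cast_nonneg m : (0:ℝ) ≤ m)]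
  refine ⟨fun j => (p.1 j : ℝ) / M, fun k j => (path p.1 p.2.1 p.2.2 k j : ℝ) / M,
    fun k j => (path p.1 p.2.1 p.2.2 (k + 1) j : ℝ) / M, ?_, fun k j => hclose _ _,
    fun k j => hclose _ _, ?_⟩
  · intro j
    rw [abs_div, abs_of_pos hMr, div_le_one hMr]
    exact_mod_cast (mem_spx.1 hp j).1
  · intro k
    by_contra! hpos
    apply hk k
    simp only [lab]
    rcases pos_and_pos_or_neg_and_neg_of_mul_pos hpos with ⟨h1, h2⟩ | ⟨h1, h2⟩
    · rw [if_neg h1.ne', if_neg h2.ne', if_pos h1, if_pos h2]; rfl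
    · rw [if_neg h1.ne, if_neg h2.ne, if_neg h1.le.not_gt, if_neg h2.le.not_gt]; rfl

theorem exists_zero_fin {N r : ℕ} (blk : Fin N → Fin r) (A : Fin N → Finset (Fin r))
    (f : Fin N → (Fin N → ℝ) → ℝ) (hf : ∀ k, Continuous (f k))
    (hflip : ∀ k i x, (∀ j, |x j| ≤ 1) → (∃ j, blk j = i ∧ |x j| = 1) →
      f k (rflip blk i x) = (if i ∈ A k then -1 else 1) * f k x)
    (hcount : (∑ σ ∈ Fintype.piFinset A,
      if (∀ i, Fintype.card {k // σ k = i} = Fintype.card {j // blk j = i}) then 1 else 0 : ZMod 2)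
      ≠ 0) : ∃ x, (∀ j, |x j| ≤ 1) ∧ ∀ k, f k x = 0 := by
  choose x y z hx hy hz hfyz using exists_approx blk A f hflip hcount
  have hxmem : ∀ m, x m ∈ Metric.closedBall (0 : Fin N → ℝ) 1 := by
    intro m
    rw [mem_closedBall_zero_iff, pi_norm_le_iff_of_nonneg zero_le_one]
    exact hx m
  obtain ⟨x0, hx0, φ, hφ, hlim⟩ := (isCompact_closedBall (0 : Fin N → ℝ) 1).tendsto_subseq hxmem
  have hsmall : Filter.Tendsto (fun n => 1 / ((φ n : ℝ) + 1)) Filter.atTop (nhds 0) :=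
    tendsto_one_div_add_atTop_nhds_zero_nat.comp hφ.tendsto_atTop
  have hlim' : ∀ y : ℕ → Fin N → ℝ, (∀ m j, |y m j - x m j| ≤ 1 / ((m : ℝ) + 1)) →
      Filter.Tendsto (fun n => y (φ n)) Filter.atTop (nhds x0) := by
    intro y hy
    rw [tendsto_pi_nhds] at hlim ⊢
    intro j
    have h1 : Filter.Tendsto (fun n => y (φ n) j - x (φ n) j) Filter.atTop (nhds 0) :=
      squeeze_zero_norm (fun n => hy (φ n) j) hsmall
    simpa using h1.add (hlim j)
  refine ⟨x0, ?_, fun k => ?_⟩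
  · rwa [mem_closedBall_zero_iff, pi_norm_le_iff_of_nonneg zero_le_one] at hx0
  · have h1 := ((hf k).tendsto x0).comp (hlim' (fun m => y m k) (fun m j => hy m k j))
    have h2 := ((hf k).tendsto x0).comp (hlim' (fun m => z m k) (fun m j => hz m k j))
    have h3 := le_of_tendsto (h1.mul h2) (Filter.Eventually.of_forall fun n => hfyz (φ n) k)
    nlinarith

theorem exists_zero {ι κ : Type*} [Fintype ι] [Fintype κ] [DecidableEq κ]
    (hcard : Fintype.card κ = Fintype.card ι) {r : ℕ}
    (blk : ι → Fin r) (A : κ → Finset (Fin r))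
    (f : κ → (ι → ℝ) → ℝ) (hf : ∀ k, Continuous (f k))
    (hflip : ∀ k i x, (∀ j, |x j| ≤ 1) → (∃ j, blk j = i ∧ |x j| = 1) →
      f k (rflip blk i x) = (if i ∈ A k then -1 else 1) * f k x)
    (hcount : (∑ σ ∈ Fintype.piFinset A,
      if (∀ i, Fintype.card {k // σ k = i} = Fintype.card {j // blk j = i}) then 1 else 0 : ZMod 2)
      ≠ 0) : ∃ x, (∀ j, |x j| ≤ 1) ∧ ∀ k, f k x = 0 := by
  obtain ⟨eι⟩ : Nonempty (Fin (Fintype.card ι) ≃ ι) := ⟨(Fintype.equivFin ι).symm⟩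
  obtain ⟨eκ⟩ : Nonempty (Fin (Fintype.card ι) ≃ κ) := ⟨(Fintype.equivFinOfCardEq hcard).symm⟩
  obtain ⟨x, hx, hx0⟩ := exists_zero_fin (blk ∘ eι) (A ∘ eκ)
    (fun k x => f (eκ k) (x ∘ eι.symm)) (fun k => (hf _).comp (by fun_prop)) (by
      intro k i x hx hb
      have e : rflip (blk ∘ eι) i x ∘ eι.symm = rflip blk i (x ∘ eι.symm) := by
        funext j
        simp [rflip]
      simp only [e]
      refine hflip (eκ k) i (x ∘ eι.symm) (fun j => hx _) ?_
      obtain ⟨j, hj, h⟩ := hb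
      exact ⟨eι j, hj, by simpa using h⟩) (by
      convert hcount using 1
      refine Finset.sum_bij' (fun σ _ => σ ∘ eκ.symm) (fun σ _ => σ ∘ eκ) ?_ ?_ ?_ ?_ ?_
      · intro σ hσ
        rw [Fintype.mem_piFinset] at hσ ⊢
        intro k
        simpa using hσ (eκ.symm k)
      · intro σ hσ
        rw [Fintype.mem_piFinset] at hσ ⊢
        intro k
        exact hσ _
      · intro σ _; funext k; simp
      · intro σ _; funext k; simp
      · intro σ _
        have h1 : ∀ i, Fintype.card {k // σ k = i} = Fintype.card {k // (σ ∘ eκ.symm) k = i} := by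
          intro i
          exact Fintype.card_congr (eκ.subtypeEquiv (by simp))
        have h2 : ∀ i, Fintype.card {k // (blk ∘ eι) k = i} = Fintype.card {k // blk k = i} := by
          intro i
          exact Fintype.card_congr (eι.subtypeEquiv (by simp))
        simp only [h1, h2])
  refine ⟨x ∘ eι.symm, fun j => hx _, fun k => ?_⟩
  simpa using hx0 (eκ.symm k)

end Equi

namespace Equi

/-- Exponent vectors of monomials in four variables. -/
abbrev Mon := ℕ × ℕ × ℕ × ℕ

/-- Polynomials in four variables over the field with two elements. -/
abbrev Pol := MvPolynomial (Fin 4) (ZMod 2)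

/-- The finitely supported function of an exponent vector. -/
def fs (m : Mon) : Fin 4 →₀ ℕ := Finsupp.equivFunOnFinite.symm ![m.1, m.2.1, m.2.2.1, m.2.2.2]

/-- The monomial of an exponent vector. -/
def mon (m : Mon) : Pol := MvPolynomial.monomial (fs m) 1

/-- The polynomial of a list of exponent vectors. -/
def sem (L : List Mon) : Pol := (L.map mon).sum

/-- Sorting key. -/
def key (m : Mon) : ℕ := m.1 * 32768 + m.2.1 * 1024 + m.2.2.1 * 32 + m.2.2.2

/-- Boolean equality of exponent vectors. -/
def meq (m n : Mon) : Bool :=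
  Nat.beq m.1 n.1 && (Nat.beq m.2.1 n.2.1 && (Nat.beq m.2.2.1 n.2.2.1 && Nat.beq m.2.2.2 n.2.2.2))

/-- Add a monomial to a sorted list modulo two. -/
def tog (m : Mon) : List Mon → List Mon
  | [] => [m]
  | n :: L => bif meq m n then L else bif Nat.ble (key m) (key n) then m :: n :: L else n :: tog m L

/-- Normal form. -/
def norm2 : List Mon → List Mon
  | [] => []
  | n :: L => tog n (norm2 L)

/-- Sum of exponent vectors. -/
def madd (m n : Mon) : Mon := (m.1 + n.1, m.2.1 + n.2.1, m.2.2.1 + n.2.2.1, m.2.2.2 + n.2.2.2)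

/-- Product of lists. -/
def mulL : List Mon → List Mon → List Mon
  | [], _ => []
  | m :: K, L => L.map (madd m) ++ mulL K L

/-- Parity vector. -/
def par (k : Mon) : Mon := (k.1 % 2, k.2.1 % 2, k.2.2.1 % 2, k.2.2.2 % 2)

/-- Halves of the exponents. -/
def half (k : Mon) : Mon := (k.1 / 2, k.2.1 / 2, k.2.2.1 / 2, k.2.2.2 / 2)

/-- The Cartier operator on lists. -/
def cart (r : Mon) : List Mon → List Mon
  | [] => []
  | m :: L => bif meq (par m) r then half m :: cart r L else cart r L

/-- Next offset. -/
def nxt (δ : ℕ) (k : Mon) : Mon :=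
  ((k.1 + k.1 % 2 + 2 - 2 * δ) / 2, (k.2.1 + k.2.1 % 2 + 2 - 2 * δ) / 2,
   (k.2.2.1 + k.2.2.1 % 2 + 2 - 2 * δ) / 2, (k.2.2.2 + k.2.2.2 % 2 + 2 - 2 * δ) / 2)

lemma fs_madd (m n : Mon) : fs (madd m n) = fs m + fs n := by
  ext j; fin_cases j <;> simp [fs, madd]

lemma mon_madd (m n : Mon) : mon (madd m n) = mon m * mon n := by
  simp [mon, fs_madd, MvPolynomial.monomial_mul]

lemma sem_cons (m : Mon) (L : List Mon) : sem (m :: L) = mon m + sem L := by simp [sem]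

lemma sem_nil : sem [] = 0 := rfl

lemma sem_append (K L : List Mon) : sem (K ++ L) = sem K + sem L := by simp [sem]

lemma meq_iff (m n : Mon) : meq m n = true ↔ m = n := by
  obtain ⟨a, b, c, d⟩ := m
  obtain ⟨a', b', c', d'⟩ := n
  simp [meq]

lemma sem_tog (m : Mon) (L : List Mon) : sem (tog m L) = mon m + sem L := by
  induction L with
  | nil => simp [tog, sem]
  | cons n L ih =>
    simp only [tog]
    cases h : meq m n
    · simp only [cond_false]
      cases Nat.ble (key m) (key n)
      · simp only [cond_false, sem_cons, ih]; ring
      · simp only [cond_true, sem_cons]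
    · rw [meq_iff] at h
      subst h
      simp only [cond_true, sem_cons, ← add_assoc, CharTwo.add_self_eq_zero, zero_add]

lemma sem_norm2 (L : List Mon) : sem (norm2 L) = sem L := by
  induction L with
  | nil => rfl
  | cons n L ih => simp [norm2, sem_tog, sem_cons, ih]

lemma sem_mulL (K L : List Mon) : sem (mulL K L) = sem K * sem L := by
  induction K with
  | nil => simp [mulL, sem_nil]
  | cons m K ih =>
    have : sem (L.map (madd m)) = mon m * sem L := by
      clear ih
      induction L with
      | nil => simp [sem_nil]
      | cons n L ih => simp [sem_cons, ih, mon_madd, mul_add]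
    simp [mulL, sem_append, sem_cons, ih, this, add_mul]

lemma coeff_cart (A : Pol) (r : Mon) (hr : par r = r) (e : Fin 4 →₀ ℕ) (L : List Mon) :
    MvPolynomial.coeff (2 • e + fs r) (A ^ 2 * sem L) = MvPolynomial.coeff e (A * sem (cart r L)) := by
  induction L with
  | nil => simp [cart, sem_nil]
  | cons m L ih =>
    have hrj : ∀ j, fs r j < 2 := by
      intro j
      rw [← hr]
      fin_cases j <;> simp [fs, par] <;> omega
    have hA : A ^ 2 = MvPolynomial.expand 2 A := (MvPolynomial.expand_zmod A).symm
    rw [sem_cons, mul_add, MvPolynomial.coeff_add, ih]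
    simp only [cart]
    cases h : meq (par m) r
    · simp only [cond_false, add_eq_right]
      rw [mon, MvPolynomial.coeff_mul_monomial']
      split_ifs with hle
      · have hex : ∃ j, fs m j % 2 ≠ fs r j := by
          by_contra! hall
          have : par m = r := by
            have h0 := hall 0
            have h1 := hall 1
            have h2 := hall 2
            have h3 := hall 3
            simp only [fs, Finsupp.equivFunOnFinite_symm_apply_apply] at h0 h1 h2 h3
            obtain ⟨a, b, c, d⟩ := r
            simp only [par, Prod.mk.injEq]
            exact ⟨h0, h1, h2, h3⟩
          rw [(meq_iff _ _).2 this] at h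
          exact absurd h (by decide)
        obtain ⟨j, hj⟩ := hex
        rw [hA, MvPolynomial.coeff_expand_of_not_dvd (i := j), zero_mul]
        have h1 := hle j
        have h2 := hrj j
        simp only [Finsupp.coe_tsub, Finsupp.coe_add, Finsupp.coe_smul, Pi.add_apply, Pi.sub_apply,
          Pi.smul_apply, smul_eq_mul] at h1 ⊢
        omega
      · rfl
    · rw [meq_iff] at h
      have hm : fs m = 2 • fs (half m) + fs r := by
        rw [← h]
        ext j
        fin_cases j <;> simp [fs, half, par] <;> omega
      simp only [cond_true]
      rw [sem_cons, mul_add, MvPolynomial.coeff_add]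
      congr 1
      rw [mon, mon, MvPolynomial.coeff_mul_monomial', MvPolynomial.coeff_mul_monomial', hm]
      have hiff : 2 • fs (half m) + fs r ≤ 2 • e + fs r ↔ fs (half m) ≤ e := by
        constructor
        · intro h j
          have := h j
          simp only [Finsupp.coe_add, Finsupp.coe_smul, Pi.add_apply, Pi.smul_apply,
            smul_eq_mul] at this
          omega
        · intro h j
          have := h j
          simp only [Finsupp.coe_add, Finsupp.coe_smul, Pi.add_apply, Pi.smul_apply,
            smul_eq_mul]
          omega
      simp only [hiff]
      split_ifs with hle
      · have : 2 • e + fs r - (2 • fs (half m) + fs r) = 2 • (e - fs (half m)) := by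
          ext j
          simp only [Finsupp.coe_tsub, Finsupp.coe_add, Finsupp.coe_smul, Pi.add_apply,
            Pi.sub_apply, Pi.smul_apply, smul_eq_mul]
          omega
        rw [this, hA, MvPolynomial.coeff_expand_smul 2 (by norm_num)]
      · rfl

/-- The linear form of a set of variables. -/
def lf (A : Finset (Fin 4)) : Pol := ∑ i ∈ A, MvPolynomial.X i

/-- The eight forms used only by the first group of masses. -/
def Tp : Pol := lf {0} * lf {0, 1} * lf {0, 2} * lf {0, 3} * lf {0, 1, 2} * lf {0, 1, 3} *
  lf {0, 2, 3} * lf {1, 2, 3}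

/-- The six forms used by all masses. -/
def Up : Pol := lf {1} * lf {2} * lf {3} * lf {1, 2} * lf {1, 3} * lf {2, 3}

/-- The three remaining orthogonality forms. -/
def Rp : Pol := lf {0, 1} * lf {0, 2} * lf {0, 3}

/-- Variable as an exponent vector. -/
def vr : ℕ → Mon
  | 0 => (1, 0, 0, 0)
  | 1 => (0, 1, 0, 0)
  | 2 => (0, 0, 1, 0)
  | _ => (0, 0, 0, 1)

lemma mon_vr (i : Fin 4) : mon (vr i) = MvPolynomial.X i := by
  have h : fs (vr i) = Finsupp.single i 1 := by
    ext j
    fin_cases i <;> fin_cases j <;> simp [fs, vr]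
  rw [mon, MvPolynomial.X, h]

/-- Product of linear forms. -/
def prodL : List (List ℕ) → List Mon
  | [] => [(0, 0, 0, 0)]
  | l :: K => norm2 (mulL (l.map vr) (prodL K))

/-- Monomials of `Up`. -/
def listU : List Mon :=
    [(0, 1, 2, 3), (0, 1, 3, 2), (0, 2, 1, 3), (0, 2, 3, 1), (0, 3, 1, 2), (0, 3, 2, 1)]

/-- Monomials of `Tp * Up`. -/
def listTU : List Mon :=
    [(1, 2, 4, 7), (1, 2, 5, 6), (1, 2, 6, 5), (1, 2, 7, 4), (1, 3, 4, 6), (1, 3, 6, 4),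
    (1, 4, 2, 7), (1, 4, 3, 6), (1, 4, 6, 3), (1, 4, 7, 2), (1, 5, 2, 6), (1, 5, 6, 2),
    (1, 6, 2, 5), (1, 6, 3, 4), (1, 6, 4, 3), (1, 6, 5, 2), (1, 7, 2, 4), (1, 7, 4, 2),
    (2, 1, 4, 7), (2, 1, 5, 6), (2, 1, 6, 5), (2, 1, 7, 4), (2, 3, 4, 5), (2, 3, 5, 4),
    (2, 4, 1, 7), (2, 4, 3, 5), (2, 4, 5, 3), (2, 4, 7, 1), (2, 5, 1, 6), (2, 5, 3, 4),
    (2, 5, 4, 3), (2, 5, 6, 1), (2, 6, 1, 5), (2, 6, 5, 1), (2, 7, 1, 4), (2, 7, 4, 1),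
    (3, 1, 4, 6), (3, 1, 6, 4), (3, 2, 4, 5), (3, 2, 5, 4), (3, 4, 1, 6), (3, 4, 2, 5),
    (3, 4, 5, 2), (3, 4, 6, 1), (3, 5, 2, 4), (3, 5, 4, 2), (3, 6, 1, 4), (3, 6, 4, 1),
    (4, 1, 2, 7), (4, 1, 3, 6), (4, 1, 6, 3), (4, 1, 7, 2), (4, 2, 1, 7), (4, 2, 3, 5),
    (4, 2, 5, 3), (4, 2, 7, 1), (4, 3, 1, 6), (4, 3, 2, 5), (4, 3, 5, 2), (4, 3, 6, 1),
    (4, 5, 2, 3), (4, 5, 3, 2), (4, 6, 1, 3), (4, 6, 3, 1), (4, 7, 1, 2), (4, 7, 2, 1),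
    (5, 1, 2, 6), (5, 1, 6, 2), (5, 2, 1, 6), (5, 2, 3, 4), (5, 2, 4, 3), (5, 2, 6, 1),
    (5, 3, 2, 4), (5, 3, 4, 2), (5, 4, 2, 3), (5, 4, 3, 2), (5, 6, 1, 2), (5, 6, 2, 1),
    (6, 1, 2, 5), (6, 1, 3, 4), (6, 1, 4, 3), (6, 1, 5, 2), (6, 2, 1, 5), (6, 2, 5, 1),
    (6, 3, 1, 4), (6, 3, 4, 1), (6, 4, 1, 3), (6, 4, 3, 1), (6, 5, 1, 2), (6, 5, 2, 1),
    (7, 1, 2, 4), (7, 1, 4, 2), (7, 2, 1, 4), (7, 2, 4, 1), (7, 4, 1, 2), (7, 4, 2, 1)]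

/-- The states of the automaton. -/
def states : List (List Mon × Mon) := [
    ([(0, 1, 1, 1), (1, 0, 1, 1), (1, 1, 0, 1), (1, 1, 1, 0), (2, 0, 0, 1), (2, 0, 1, 0),
    (2, 1, 0, 0), (3, 0, 0, 0)], (2, 2, 3, 4)),
    ([(0, 1, 1, 2), (0, 2, 1, 1), (1, 1, 0, 2), (1, 2, 0, 1)], (2, 2, 3, 3)),
    ([(1, 2, 1, 4), (1, 4, 1, 2), (2, 1, 1, 4), (2, 2, 0, 4), (2, 4, 0, 2), (2, 4, 1, 1),
    (3, 1, 0, 4), (3, 4, 0, 1), (4, 1, 1, 2), (4, 2, 1, 1), (5, 1, 0, 2), (5, 2, 0, 1)], (1, 1, 2, 2)),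
    ([(0, 1, 1, 2), (0, 2, 1, 1)], (2, 2, 3, 3)),
    ([(1, 1, 2, 4), (1, 1, 3, 3), (1, 2, 3, 2), (1, 3, 1, 3), (1, 3, 2, 2), (1, 4, 1, 2),
    (2, 1, 1, 4), (2, 1, 3, 2), (2, 2, 1, 3), (2, 2, 2, 2), (2, 2, 3, 1), (2, 3, 0, 3),
    (2, 3, 1, 2), (2, 3, 2, 1), (2, 4, 0, 2), (2, 4, 1, 1), (3, 1, 1, 3), (3, 1, 2, 2),
    (3, 2, 0, 3), (3, 2, 1, 2), (3, 2, 2, 1), (3, 4, 0, 1), (4, 2, 0, 2), (4, 3, 0, 1)], (1, 1, 2, 2)),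
    ([(0, 1, 2, 3), (0, 2, 1, 3), (0, 2, 2, 2), (0, 3, 1, 2), (1, 2, 1, 2), (1, 3, 1, 1),
    (2, 1, 1, 2), (2, 2, 1, 1)], (2, 2, 2, 2)),
    ([(1, 2, 3, 4), (1, 3, 2, 4), (1, 4, 3, 2), (1, 5, 2, 2), (2, 1, 3, 4), (2, 3, 1, 4),
    (2, 4, 2, 2), (2, 4, 3, 1), (2, 5, 1, 2), (2, 5, 2, 1), (3, 1, 2, 4), (3, 2, 1, 4),
    (3, 4, 2, 1), (3, 5, 1, 1), (4, 1, 3, 2), (4, 2, 2, 2), (4, 2, 3, 1), (4, 3, 2, 1),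
    (5, 1, 2, 2), (5, 2, 1, 2), (5, 2, 2, 1), (5, 3, 1, 1)], (1, 1, 1, 1)),
    ([(1, 1, 2, 4), (1, 1, 3, 3), (1, 2, 2, 3), (1, 3, 2, 2), (1, 3, 3, 1), (1, 4, 2, 1),
    (2, 1, 1, 4), (2, 1, 3, 2), (2, 2, 1, 3), (2, 2, 3, 1), (2, 3, 1, 2), (2, 4, 1, 1),
    (3, 1, 1, 3), (3, 1, 2, 2), (3, 2, 2, 1), (3, 3, 1, 1)], (1, 1, 2, 2)),
    ([(0, 1, 2, 3), (0, 2, 1, 3), (0, 2, 2, 2), (0, 3, 1, 2), (1, 1, 2, 2), (1, 2, 1, 2),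
    (1, 2, 2, 1), (1, 3, 1, 1)], (2, 2, 2, 2)),
    ([(1, 1, 3, 5), (1, 1, 4, 4), (1, 2, 2, 5), (1, 2, 3, 4), (1, 2, 4, 3), (1, 3, 3, 3),
    (1, 4, 3, 2), (1, 5, 2, 2), (2, 1, 3, 4), (2, 1, 4, 3), (2, 2, 1, 5), (2, 2, 2, 4),
    (2, 2, 3, 3), (2, 2, 4, 2), (2, 3, 2, 3), (2, 3, 3, 2), (2, 4, 2, 2), (2, 4, 3, 1),
    (2, 5, 1, 2), (2, 5, 2, 1), (3, 1, 1, 5), (3, 1, 3, 3), (3, 2, 2, 3), (3, 2, 3, 2),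
    (3, 4, 2, 1), (3, 5, 1, 1), (4, 1, 2, 3), (4, 1, 3, 2), (4, 2, 1, 3), (4, 2, 3, 1),
    (4, 3, 1, 2), (4, 3, 2, 1), (5, 1, 1, 3), (5, 1, 2, 2), (5, 2, 2, 1), (5, 3, 1, 1)], (1, 1, 1, 1)),
    ([(0, 1, 2, 3), (0, 2, 1, 3), (0, 2, 2, 2), (0, 3, 1, 2), (1, 1, 2, 2), (1, 2, 2, 1)], (2, 2, 2, 2)),
    ([(1, 1, 3, 5), (1, 1, 4, 4), (1, 2, 3, 4), (1, 3, 1, 5), (1, 3, 3, 3), (1, 3, 4, 2),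
    (1, 4, 3, 2), (1, 5, 1, 3), (2, 1, 2, 5), (2, 1, 3, 4), (2, 2, 1, 5), (2, 2, 2, 4),
    (2, 2, 3, 3), (2, 2, 4, 2), (2, 3, 2, 3), (2, 3, 3, 2), (2, 3, 4, 1), (2, 4, 2, 2),
    (2, 4, 3, 1), (2, 5, 1, 2), (3, 1, 3, 3), (3, 1, 4, 2), (3, 2, 2, 3), (3, 2, 3, 2),
    (3, 2, 4, 1), (3, 4, 2, 1), (4, 1, 2, 3), (4, 1, 3, 2), (4, 2, 1, 3), (4, 2, 3, 1),
    (4, 3, 1, 2), (4, 3, 2, 1)], (1, 1, 1, 1)),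
    ([(0, 1, 3, 2), (0, 2, 2, 2), (0, 2, 3, 1), (0, 3, 2, 1), (1, 1, 1, 3), (1, 2, 1, 2)], (2, 2, 2, 2)),
    ([(1, 1, 4, 4), (1, 1, 5, 3), (1, 2, 3, 4), (1, 3, 3, 3), (1, 3, 4, 2), (1, 3, 5, 1),
    (1, 4, 3, 2), (1, 5, 3, 1), (2, 1, 3, 4), (2, 1, 5, 2), (2, 2, 2, 4), (2, 2, 3, 3),
    (2, 2, 4, 2), (2, 2, 5, 1), (2, 3, 2, 3), (2, 3, 3, 2), (2, 3, 4, 1), (2, 4, 2, 2),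
    (2, 4, 3, 1), (2, 5, 2, 1), (3, 1, 3, 3), (3, 1, 4, 2), (3, 2, 2, 3), (3, 2, 3, 2),
    (3, 2, 4, 1), (3, 4, 2, 1)], (1, 1, 1, 1)),
    ([(0, 1, 2, 3), (0, 2, 1, 3), (0, 2, 2, 2), (0, 3, 1, 2)], (2, 2, 2, 2)),
    ([(1, 1, 3, 5), (1, 1, 4, 4), (1, 2, 4, 3), (1, 3, 1, 5), (1, 3, 2, 4), (1, 3, 3, 3),
    (1, 4, 2, 3), (1, 5, 1, 3), (2, 1, 2, 5), (2, 1, 3, 4), (2, 2, 1, 5), (2, 2, 2, 4),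
    (2, 2, 4, 2), (2, 3, 1, 4), (2, 3, 2, 3), (2, 3, 4, 1), (2, 4, 1, 3), (2, 4, 2, 2),
    (2, 4, 3, 1), (2, 5, 1, 2), (3, 1, 3, 3), (3, 1, 4, 2), (3, 2, 1, 4), (3, 2, 3, 2),
    (3, 2, 4, 1), (3, 3, 2, 2), (3, 4, 1, 2), (3, 4, 2, 1), (4, 1, 2, 3), (4, 1, 3, 2),
    (4, 2, 3, 1), (4, 3, 2, 1)], (1, 1, 1, 1)),
    ([(0, 1, 3, 2), (0, 2, 2, 2), (0, 2, 3, 1), (0, 3, 2, 1), (1, 1, 2, 2), (1, 2, 1, 2),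
    (1, 2, 2, 1), (1, 3, 1, 1)], (2, 2, 2, 2)),
    ([(0, 1, 3, 2), (0, 2, 2, 2), (0, 2, 3, 1), (0, 3, 2, 1)], (2, 2, 2, 2)),
    ([(1, 1, 4, 4), (1, 1, 5, 3), (1, 2, 4, 3), (1, 3, 2, 4), (1, 3, 3, 3), (1, 3, 5, 1),
    (1, 4, 2, 3), (1, 5, 3, 1), (2, 1, 3, 4), (2, 1, 5, 2), (2, 2, 2, 4), (2, 2, 4, 2),
    (2, 2, 5, 1), (2, 3, 1, 4), (2, 3, 2, 3), (2, 3, 4, 1), (2, 4, 1, 3), (2, 4, 2, 2),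
    (2, 4, 3, 1), (2, 5, 2, 1), (3, 1, 3, 3), (3, 1, 4, 2), (3, 2, 1, 4), (3, 2, 3, 2),
    (3, 2, 4, 1), (3, 3, 2, 2), (3, 4, 1, 2), (3, 4, 2, 1), (4, 2, 1, 3), (4, 3, 1, 2)], (1, 1, 1, 1)),
    ([(1, 1, 3, 5), (1, 1, 4, 4), (1, 2, 4, 3), (1, 3, 1, 5), (1, 3, 2, 4), (1, 3, 3, 3),
    (1, 4, 2, 3), (1, 5, 1, 3), (2, 1, 2, 5), (2, 1, 4, 3), (2, 2, 1, 5), (2, 2, 2, 4),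
    (2, 2, 3, 3), (2, 2, 4, 2), (2, 3, 1, 4), (2, 3, 2, 3), (2, 3, 3, 2), (2, 4, 1, 3),
    (2, 4, 2, 2), (2, 5, 1, 2), (3, 1, 2, 4), (3, 1, 3, 3), (3, 2, 1, 4), (3, 2, 2, 3),
    (3, 2, 3, 2), (3, 4, 1, 2)], (1, 1, 1, 1)),
    ([(0, 1, 2, 3), (0, 2, 1, 3), (0, 2, 2, 2), (0, 3, 1, 2), (1, 1, 1, 3), (1, 2, 1, 2)], (2, 2, 2, 2)),
    ([(1, 1, 4, 4), (1, 1, 5, 3), (1, 2, 2, 5), (1, 2, 3, 4), (1, 2, 4, 3), (1, 3, 1, 5),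
    (1, 3, 3, 3), (1, 3, 5, 1), (1, 4, 3, 2), (1, 5, 1, 3), (1, 5, 2, 2), (1, 5, 3, 1),
    (2, 1, 2, 5), (2, 1, 3, 4), (2, 1, 4, 3), (2, 1, 5, 2), (2, 2, 2, 4), (2, 2, 3, 3),
    (2, 2, 4, 2), (2, 2, 5, 1), (2, 3, 2, 3), (2, 3, 3, 2), (2, 4, 2, 2), (2, 4, 3, 1),
    (3, 1, 1, 5), (3, 1, 3, 3), (3, 2, 2, 3), (3, 2, 3, 2), (3, 4, 2, 1), (3, 5, 1, 1),
    (5, 1, 1, 3), (5, 1, 2, 2), (5, 2, 2, 1), (5, 3, 1, 1)], (1, 1, 1, 1)),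
    ([(1, 1, 4, 4), (1, 1, 5, 3), (1, 2, 4, 3), (1, 3, 2, 4), (1, 3, 3, 3), (1, 3, 5, 1),
    (1, 4, 2, 3), (1, 5, 3, 1), (2, 1, 4, 3), (2, 1, 5, 2), (2, 2, 2, 4), (2, 2, 3, 3),
    (2, 2, 4, 2), (2, 2, 5, 1), (2, 3, 1, 4), (2, 3, 2, 3), (2, 3, 3, 2), (2, 4, 1, 3),
    (2, 4, 2, 2), (2, 5, 2, 1), (3, 1, 2, 4), (3, 1, 3, 3), (3, 2, 1, 4), (3, 2, 2, 3),
    (3, 2, 3, 2), (3, 4, 1, 2), (4, 1, 2, 3), (4, 1, 3, 2), (4, 2, 1, 3), (4, 2, 3, 1),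
    (4, 3, 1, 2), (4, 3, 2, 1)], (1, 1, 1, 1)),
    ([(1, 1, 3, 5), (1, 1, 4, 4), (1, 2, 3, 4), (1, 3, 1, 5), (1, 3, 3, 3), (1, 3, 4, 2),
    (1, 4, 3, 2), (1, 5, 1, 3), (2, 1, 2, 5), (2, 1, 4, 3), (2, 2, 1, 5), (2, 2, 2, 4),
    (2, 2, 4, 2), (2, 3, 2, 3), (2, 4, 2, 2), (2, 5, 1, 2), (3, 1, 2, 4), (3, 1, 3, 3),
    (3, 2, 3, 2), (3, 3, 2, 2), (4, 2, 1, 3), (4, 3, 1, 2)], (1, 1, 1, 1)),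
    ([(1, 1, 4, 4), (1, 1, 5, 3), (1, 2, 2, 5), (1, 3, 1, 5), (1, 3, 2, 4), (1, 3, 3, 3),
    (1, 3, 4, 2), (1, 3, 5, 1), (1, 4, 2, 3), (1, 5, 1, 3), (1, 5, 2, 2), (1, 5, 3, 1),
    (2, 1, 2, 5), (2, 1, 5, 2), (2, 2, 2, 4), (2, 2, 3, 3), (2, 2, 4, 2), (2, 2, 5, 1),
    (2, 3, 1, 4), (2, 3, 2, 3), (2, 3, 3, 2), (2, 3, 4, 1), (2, 4, 1, 3), (2, 4, 2, 2),
    (3, 1, 1, 5), (3, 1, 2, 4), (3, 1, 3, 3), (3, 1, 4, 2), (3, 2, 1, 4), (3, 2, 2, 3),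
    (3, 2, 3, 2), (3, 2, 4, 1), (3, 4, 1, 2), (3, 5, 1, 1), (4, 1, 2, 3), (4, 1, 3, 2),
    (4, 2, 1, 3), (4, 2, 3, 1), (4, 3, 1, 2), (4, 3, 2, 1), (5, 1, 1, 3), (5, 1, 2, 2),
    (5, 2, 2, 1), (5, 3, 1, 1)], (1, 1, 1, 1)),
    ([(0, 1, 3, 2), (0, 2, 2, 2), (0, 2, 3, 1), (0, 3, 2, 1), (1, 2, 1, 2), (1, 3, 1, 1),
    (2, 1, 1, 2), (2, 2, 1, 1)], (2, 2, 2, 2)),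
    ([(0, 1, 3, 2), (0, 2, 2, 2), (0, 2, 3, 1), (0, 3, 2, 1), (1, 1, 2, 2), (1, 2, 2, 1)], (2, 2, 2, 2)),
    ([(1, 1, 4, 4), (1, 1, 5, 3), (1, 2, 3, 4), (1, 3, 3, 3), (1, 3, 4, 2), (1, 3, 5, 1),
    (1, 4, 3, 2), (1, 5, 3, 1), (2, 1, 4, 3), (2, 1, 5, 2), (2, 2, 2, 4), (2, 2, 4, 2),
    (2, 2, 5, 1), (2, 3, 2, 3), (2, 4, 2, 2), (2, 5, 2, 1), (3, 1, 2, 4), (3, 1, 3, 3),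
    (3, 2, 3, 2), (3, 3, 2, 2), (4, 1, 2, 3), (4, 1, 3, 2), (4, 2, 3, 1), (4, 3, 2, 1)], (1, 1, 1, 1)),
    ([(1, 1, 3, 5), (1, 1, 4, 4), (1, 2, 2, 5), (1, 3, 2, 4), (1, 3, 3, 3), (1, 3, 4, 2),
    (1, 4, 2, 3), (1, 5, 2, 2), (2, 2, 1, 5), (2, 2, 2, 4), (2, 2, 3, 3), (2, 2, 4, 2),
    (2, 3, 1, 4), (2, 3, 2, 3), (2, 3, 3, 2), (2, 3, 4, 1), (2, 4, 1, 3), (2, 4, 2, 2),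
    (2, 5, 1, 2), (2, 5, 2, 1), (3, 1, 1, 5), (3, 1, 2, 4), (3, 1, 3, 3), (3, 1, 4, 2),
    (3, 2, 1, 4), (3, 2, 2, 3), (3, 2, 3, 2), (3, 2, 4, 1), (3, 4, 1, 2), (3, 5, 1, 1),
    (5, 1, 1, 3), (5, 1, 2, 2), (5, 2, 2, 1), (5, 3, 1, 1)], (1, 1, 1, 1))]

/-- The transitions of the automaton. -/
def trans : List (ℕ × ℕ) :=
    [(1, 2), (3, 4), (5, 6), (3, 7), (8, 9), (10, 11), (8, 6), (12, 13), (14, 11), (5, 9), (14, 15), (16, 11), (17, 18), (16, 13), (14, 19), (20, 21), (17, 22), (17, 13), (20, 9), (8, 19), (14, 23), (5, 21), (8, 22), (12, 24), (25, 24), (26, 22), (17, 27), (12, 28), (25, 28)]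

/-- The state with number `i`. -/
def stB (i : ℕ) : List Mon := (states.getD i ([], (0, 0, 0, 0))).1

/-- The offset of state `i`. -/
def stK (i : ℕ) : Mon := (states.getD i ([], (0, 0, 0, 0))).2

/-- Successors. -/
def succ0 (i : ℕ) : ℕ := (trans.getD i (0, 0)).1

/-- Successors. -/
def succ1 (i : ℕ) : ℕ := (trans.getD i (0, 0)).2

/-- The exceptional states. -/
def bad (i : ℕ) : Bool := Nat.beq i 0 || (Nat.beq i 2 || Nat.beq i 6)

/-- Parity of the multiplicity. -/
def cnt (m : Mon) : List Mon → Bool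
  | [] => false
  | n :: L => bif meq n m then !(cnt m L) else cnt m L

/-- Complement to seven. -/
def co7 (k : Mon) : Mon := (7 - k.1, 7 - k.2.1, 7 - k.2.2.1, 7 - k.2.2.2)

lemma chk_U : prodL [[1], [2], [3], [1, 2], [1, 3], [2, 3]] = listU := by decide +kernel

lemma chk_TU : prodL [[0], [0, 1], [0, 2], [0, 3], [0, 1, 2], [0, 1, 3], [0, 2, 3], [1, 2, 3],
    [1], [2], [3], [1, 2], [1, 3], [2, 3]] = listTU := by decide +kernel

lemma chk_R : prodL [[0, 1], [0, 2], [0, 3]] = stB 0 := by decide +kernel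

lemma chk_0 : ∀ i < 29, norm2 (cart (par (stK i)) (mulL listU (stB i))) = stB (succ0 i) ∧
    nxt 0 (stK i) = stK (succ0 i) ∧ succ0 i < 29 ∧ bad (succ0 i) = false := by decide +kernel

lemma chk_1 : ∀ i < 29, norm2 (cart (par (stK i)) (mulL listTU (stB i))) = stB (succ1 i) ∧
    nxt 1 (stK i) = stK (succ1 i) ∧ succ1 i < 29 ∧ (bad (succ1 i) = true → bad i = true) := by
  decide +kernel

lemma chk_base : ∀ i < 29, bad i = false → cnt (co7 (stK i)) (mulL listTU (stB i)) = true := by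
  decide +kernel

lemma sem_prodL_cons (l : List ℕ) (K : List (List ℕ)) :
    sem (prodL (l :: K)) = sem (l.map vr) * sem (prodL K) := by
  simp only [prodL, sem_norm2, sem_mulL]

lemma sem_prodL_nil : sem (prodL []) = 1 := by
  have : fs (0, 0, 0, 0) = 0 := by
    ext j; fin_cases j <;> simp [fs]
  simp [prodL, sem, mon, this]

lemma mon_vr0 : mon (vr 0) = MvPolynomial.X 0 := mon_vr 0
lemma mon_vr1 : mon (vr 1) = MvPolynomial.X 1 := mon_vr 1
lemma mon_vr2 : mon (vr 2) = MvPolynomial.X 2 := mon_vr 2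
lemma mon_vr3 : mon (vr 3) = MvPolynomial.X 3 := mon_vr 3

lemma lf1 (i : Fin 4) : lf {i} = MvPolynomial.X i := by simp [lf]
lemma lf2 {i j : Fin 4} (h : i ≠ j) : lf {i, j} = MvPolynomial.X i + MvPolynomial.X j := by
  simp [lf, Finset.sum_pair h]
lemma lf3 {i j k : Fin 4} (h : i ≠ j) (h' : i ≠ k) (h2 : j ≠ k) :
    lf {i, j, k} = MvPolynomial.X i + (MvPolynomial.X j + MvPolynomial.X k) := by
  rw [lf, Finset.sum_insert (by simp [h, h']), Finset.sum_pair h2]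

lemma sem_listU : sem listU = Up := by
  rw [← chk_U]
  simp only [sem_prodL_cons, sem_prodL_nil, List.map_cons, List.map_nil, sem_cons, sem_nil,
    mon_vr0, mon_vr1, mon_vr2, mon_vr3, Up, lf1]
  rw [lf2 (by decide), lf2 (by decide), lf2 (by decide)]
  ring

lemma sem_listTU : sem listTU = Tp * Up := by
  rw [← sem_listU, ← chk_U, ← chk_TU]
  simp only [sem_prodL_cons, List.map_cons, List.map_nil, sem_cons, sem_nil,
    mon_vr0, mon_vr1, mon_vr2, mon_vr3, Tp, lf1]
  rw [lf2 (by decide), lf2 (by decide), lf2 (by decide), lf3 (by decide) (by decide) (by decide),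
    lf3 (by decide) (by decide) (by decide), lf3 (by decide) (by decide) (by decide),
    lf3 (by decide) (by decide) (by decide)]
  simp only [add_zero, mul_assoc]

lemma sem_stB0 : sem (stB 0) = Rp := by
  rw [← chk_R]
  simp only [sem_prodL_cons, sem_prodL_nil, List.map_cons, List.map_nil, sem_cons, sem_nil,
    mon_vr0, mon_vr1, mon_vr2, mon_vr3, Rp]
  rw [lf2 (by decide), lf2 (by decide), lf2 (by decide)]
  ring

lemma fs_injective {m n : Mon} (h : fs m = fs n) : m = n := by
  have h0 := DFunLike.congr_fun h 0
  have h1 := DFunLike.congr_fun h 1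
  have h2 := DFunLike.congr_fun h 2
  have h3 := DFunLike.congr_fun h 3
  obtain ⟨a, b, c, d⟩ := m
  obtain ⟨a', b', c', d'⟩ := n
  simp [fs] at h0 h1 h2 h3
  subst h0 h1 h2 h3
  rfl

lemma coeff_sem (m : Mon) (L : List Mon) :
    MvPolynomial.coeff (fs m) (sem L) = if cnt m L then 1 else 0 := by
  induction L with
  | nil => simp [sem_nil, cnt]
  | cons n L ih =>
    rw [sem_cons, MvPolynomial.coeff_add, ih, mon, MvPolynomial.coeff_monomial]
    have hc : cnt m (n :: L) = bif meq n m then !(cnt m L) else cnt m L := rfl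
    rw [hc]
    by_cases h : n = m
    · subst h
      rw [(meq_iff n n).2 rfl]
      by_cases h2 : cnt n L = true
      · simp [h2]; rfl
      · simp [h2]
    · have h3 : fs n ≠ fs m := fun h' => h (fs_injective h')
      have h4 : meq n m = false := by
        rw [Bool.eq_false_iff, Ne, meq_iff]; exact h
      simp [h3, h4]

/-- Recover an exponent vector. -/
def toMon (e : Fin 4 →₀ ℕ) : Mon := (e 0, e 1, e 2, e 3)

lemma fs_toMon (e : Fin 4 →₀ ℕ) : fs (toMon e) = e := by
  ext j; fin_cases j <;> simp [fs, toMon]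

lemma par_par (m : Mon) : par (par m) = par m := by simp [par]

lemma chk_K : ∀ i < 29, (stK i).1 ≤ 7 ∧ (stK i).2.1 ≤ 7 ∧ (stK i).2.2.1 ≤ 7 ∧
    (stK i).2.2.2 ≤ 7 := by decide +kernel

lemma nxt_fs (δ : ℕ) (hδ : δ ≤ 1) (k : Mon) (j : Fin 4) :
    2 * fs (nxt δ k) j + 2 * δ = fs k j + fs (par k) j + 2 ∧ fs (par k) j = fs k j % 2 := by
  fin_cases j <;> simp [fs, nxt, par] <;> omega

lemma auto_main (q : ℕ) : ∀ (a i : ℕ), i < 29 → 2 ^ q ≤ a → a < 2 * 2 ^ q →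
    (bad i = true → a + 1 ≠ 2 * 2 ^ q) → ∀ e : Fin 4 →₀ ℕ,
    (∀ j, e j + fs (stK i) j = 3 * 2 ^ q + 2 * a + 2) →
    MvPolynomial.coeff e (Tp ^ a * Up ^ (2 * 2 ^ q - 1) * sem (stB i)) = 1 := by
  induction q with
  | zero =>
    intro a i hi h1 h2 hb e he
    obtain rfl : a = 1 := by simp at h1 h2; omega
    have hbad : bad i = false := by
      cases h : bad i
      · rfl
      · exact absurd rfl (hb h)
    have hK : e = fs (co7 (stK i)) := by
      obtain ⟨k1, k2, k3, k4⟩ := chk_K i hi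
      ext j
      have := he j
      fin_cases j <;> simp [fs, co7] at this ⊢ <;> omega
    have : Tp ^ 1 * Up ^ (2 * 2 ^ 0 - 1) * sem (stB i) = sem (mulL listTU (stB i)) := by
      rw [sem_mulL, sem_listTU]; norm_num
    rw [this, hK, coeff_sem, chk_base i hi hbad]
    rfl
  | succ q ih =>
    intro a i hi h1 h2 hb e he
    have hpos : 1 ≤ 2 ^ q := Nat.one_le_two_pow
    have hpow : 2 ^ (q + 1) = 2 * 2 ^ q := by ring
    rw [hpow] at h1 h2 hb he ⊢
    generalize 2 ^ q = m at *
    obtain ⟨a', δ, hδ, rfl⟩ : ∃ a' δ, δ ≤ 1 ∧ a = 2 * a' + δ := ⟨a / 2, a % 2, by omega, by omega⟩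
    have hP : Tp ^ (2 * a' + δ) * Up ^ (2 * (2 * m) - 1) * sem (stB i) =
        (Tp ^ a' * Up ^ (2 * m - 1)) ^ 2 * (Tp ^ δ * Up * sem (stB i)) := by
      have : 2 * (2 * m) - 1 = 2 * (2 * m - 1) + 1 := by omega
      rw [this]; ring
    obtain ⟨e', he'⟩ : ∃ e' : Fin 4 →₀ ℕ, e = 2 • e' + fs (par (stK i)) ∧
        ∀ j, e' j + fs (nxt δ (stK i)) j = 3 * m + 2 * a' + 2 := by
      refine ⟨e.mapRange (fun x => x / 2) (by simp), ?_, ?_⟩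
      · ext j
        have h3 := he j
        have h4 := nxt_fs δ hδ (stK i) j
        simp only [Finsupp.coe_add, Finsupp.coe_smul, Pi.add_apply, Pi.smul_apply,
            smul_eq_mul, Finsupp.mapRange_apply]
        omega
      · intro j
        have h3 := he j
        have h4 := nxt_fs δ hδ (stK i) j
        simp only [Finsupp.mapRange_apply]
        omega
    obtain ⟨he1, he2⟩ := he'
    interval_cases δ
    · obtain ⟨c1, c2, c3, c4⟩ := chk_0 i hi
      have hs : Tp ^ 0 * Up * sem (stB i) = sem (mulL listU (stB i)) := by
        rw [sem_mulL, sem_listU]; ring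
      rw [hP, hs, he1, coeff_cart _ _ (par_par _), ← sem_norm2, c1]
      refine ih a' _ c3 (by omega) (by omega) (by simp [c4]) e' ?_
      rw [← c2]; exact he2
    · obtain ⟨c1, c2, c3, c4⟩ := chk_1 i hi
      have hs : Tp ^ 1 * Up * sem (stB i) = sem (mulL listTU (stB i)) := by
        rw [sem_mulL, sem_listTU]; ring
      rw [hP, hs, he1, coeff_cart _ _ (par_par _), ← sem_norm2, c1]
      refine ih a' _ c3 (by omega) (by omega) ?_ e' ?_
      · intro hb'
        have := hb (c4 hb')
        omega
      · rw [← c2]; exact he2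

/-- The parity of the relevant coefficient. -/
theorem coeff_odd (q a : ℕ) (h1 : 2 ^ q ≤ a) (h2 : a + 1 < 2 * 2 ^ q) (e : Fin 4 →₀ ℕ)
    (h0 : e 0 = 3 * 2 ^ q + 2 * a) (he1 : e 1 + 1 = 3 * 2 ^ q + 2 * a)
    (he2 : e 2 + 2 = 3 * 2 ^ q + 2 * a) (he3 : e 3 + 3 = 3 * 2 ^ q + 2 * a) :
    MvPolynomial.coeff e (Tp ^ a * Up ^ (2 * 2 ^ q - 2) *
      (lf {0, 1} * lf {0, 2} * lf {0, 3} * lf {1, 2} * lf {1, 3} * lf {2, 3})) = 1 := by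
  have hpos : 1 ≤ 2 ^ q := Nat.one_le_two_pow
  have hU : Tp ^ a * Up ^ (2 * 2 ^ q - 2) *
      (lf {0, 1} * lf {0, 2} * lf {0, 3} * lf {1, 2} * lf {1, 3} * lf {2, 3}) *
      MvPolynomial.monomial (fs (0, 1, 1, 1)) 1 =
      Tp ^ a * Up ^ (2 * 2 ^ q - 1) * sem (stB 0) := by
    have h : (MvPolynomial.monomial (fs (0, 1, 1, 1)) 1 : Pol) = lf {1} * lf {2} * lf {3} := by
      have := mon_madd (vr 1) (madd (vr 2) (vr 3))
      rw [mon_madd (vr 2), mon_vr1, mon_vr2, mon_vr3] at this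
      rw [lf1, lf1, lf1, mul_assoc, ← this]
      rfl
    have h' : 2 * 2 ^ q - 1 = (2 * 2 ^ q - 2) + 1 := by omega
    rw [h, h', sem_stB0, Rp, pow_succ]
    nth_rewrite 3 [Up]
    ring
  have h := auto_main q a 0 (by norm_num) h1 (by omega) (by intro _; omega)
    (e + fs (0, 1, 1, 1)) (by
      intro j
      have : stK 0 = (2, 2, 3, 4) := rfl
      rw [this]
      fin_cases j <;> simp [fs] <;> omega)
  rw [← hU, MvPolynomial.coeff_mul_monomial, mul_one] at h
  exact h

end Equi

namespace Equi

lemma hyperplane_null {d : ℕ} (a : EuclideanSpace ℝ (Fin d)) (b : ℝ) (h : a ≠ 0 ∨ b ≠ 0) :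
    volume {y : EuclideanSpace ℝ (Fin d) | ⟪a, y⟫ - b = 0} = 0 := by
  by_cases ha : a = 0
  · have hb : b ≠ 0 := by
      rcases h with h | h
      · exact absurd ha h
      · exact h
    have : {y : EuclideanSpace ℝ (Fin d) | ⟪a, y⟫ - b = 0} = ∅ := by
      ext y; simp [ha, hb]
    rw [this]; simp
  · have hn : ⟪a, a⟫ ≠ 0 := by simpa using ha
    set y0 : EuclideanSpace ℝ (Fin d) := (b / ⟪a, a⟫) • a
    have hy0 : ⟪a, y0⟫ = b := by
      rw [inner_smul_right, div_mul_cancel₀ _ hn]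
    have e : {y : EuclideanSpace ℝ (Fin d) | ⟪a, y⟫ - b = 0} =
        (fun y => y + (-y0)) ⁻¹' ((LinearMap.ker (innerSL ℝ a).toLinearMap :
          Submodule ℝ (EuclideanSpace ℝ (Fin d))) : Set (EuclideanSpace ℝ (Fin d))) := by
      ext y
      simp [inner_add_right, hy0, sub_eq_add_neg]
    rw [e, measure_preimage_add_right]
    apply Measure.addHaar_submodule
    intro htop
    have : a ∈ LinearMap.ker (innerSL ℝ a).toLinearMap := by rw [htop]; trivial
    apply hn
    simpa using this

lemma ae_ne {d : ℕ} {μ : Measure (EuclideanSpace ℝ (Fin d))} (hμ : μ ≪ volume)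
    (a : EuclideanSpace ℝ (Fin d)) (b : ℝ) (h : a ≠ 0 ∨ b ≠ 0) : ∀ᵐ y ∂μ, ⟪a, y⟫ - b ≠ 0 := by
  rw [ae_iff]
  simp only [not_not]
  exact hμ (hyperplane_null a b h)

/-- The sign of the affine function. -/
def sg {d : ℕ} (a : EuclideanSpace ℝ (Fin d)) (b : ℝ) (y : EuclideanSpace ℝ (Fin d)) : ℝ :=
  Real.sign (⟪a, y⟫ - b)

lemma measurable_rsign : Measurable Real.sign := by
  unfold Real.sign
  exact Measurable.ite measurableSet_Iio measurable_const
    (Measurable.ite measurableSet_Ioi measurable_const measurable_const)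

lemma abs_rsign_le (x : ℝ) : |Real.sign x| ≤ 1 := by
  unfold Real.sign
  split_ifs <;> simp

lemma continuousAt_rsign {x : ℝ} (h : x ≠ 0) : ContinuousAt Real.sign x := by
  rcases lt_or_gt_of_ne h with h | h
  · refine (continuousAt_const (y := (-1 : ℝ))).congr ?_
    filter_upwards [Iio_mem_nhds h] with y hy
    exact (Real.sign_of_neg hy).symm
  · refine (continuousAt_const (y := (1 : ℝ))).congr ?_
    filter_upwards [Ioi_mem_nhds h] with y hy
    exact (Real.sign_of_pos hy).symm

lemma measurable_sg {d : ℕ} (a : EuclideanSpace ℝ (Fin d)) (b : ℝ) : Measurable (sg a b) := by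
  apply measurable_rsign.comp
  have : Continuous fun y : EuclideanSpace ℝ (Fin d) => ⟪a, y⟫ - b := by fun_prop
  exact this.measurable

lemma sg_neg {d : ℕ} (a : EuclideanSpace ℝ (Fin d)) (b : ℝ) (y) : sg (-a) (-b) y = - sg a b y := by
  rw [sg, sg, ← Real.sign_neg]
  congr 1
  rw [inner_neg_left]; ring

/-- The test functions. -/
def FF {d : ℕ} (μ : Measure (EuclideanSpace ℝ (Fin d))) (A : Finset (Fin 4))
    (a : Fin 4 → EuclideanSpace ℝ (Fin d)) (b : Fin 4 → ℝ) : ℝ :=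
  ∫ y, ∏ i ∈ A, sg (a i) (b i) y ∂μ

lemma abs_prod_sg_le {d : ℕ} (A : Finset (Fin 4)) (a : Fin 4 → EuclideanSpace ℝ (Fin d))
    (b : Fin 4 → ℝ) (y) : ‖∏ i ∈ A, sg (a i) (b i) y‖ ≤ 1 := by
  rw [Real.norm_eq_abs, Finset.abs_prod]
  exact Finset.prod_le_one (fun _ _ => abs_nonneg _) (fun _ _ => abs_rsign_le _)

lemma measurable_prod_sg {d : ℕ} (A : Finset (Fin 4)) (a : Fin 4 → EuclideanSpace ℝ (Fin d))
    (b : Fin 4 → ℝ) : Measurable (fun y => ∏ i ∈ A, sg (a i) (b i) y) :=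
  Finset.measurable_fun_prod _ (fun i _ => measurable_sg _ _)

lemma integrable_prod_sg {d : ℕ} (μ : Measure (EuclideanSpace ℝ (Fin d))) [IsFiniteMeasure μ]
    (A : Finset (Fin 4)) (a : Fin 4 → EuclideanSpace ℝ (Fin d))
    (b : Fin 4 → ℝ) : Integrable (fun y => ∏ i ∈ A, sg (a i) (b i) y) μ :=
  Integrable.of_bound (measurable_prod_sg A a b).aestronglyMeasurable 1
    (Filter.Eventually.of_forall (abs_prod_sg_le A a b))

lemma continuous_FF {d : ℕ} {X : Type*} [TopologicalSpace X] [FirstCountableTopology X]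
    (μ : Measure (EuclideanSpace ℝ (Fin d))) [IsFiniteMeasure μ] (hμ : μ ≪ volume)
    (A : Finset (Fin 4)) (a : X → Fin 4 → EuclideanSpace ℝ (Fin d)) (b : X → Fin 4 → ℝ)
    (ha : ∀ i, Continuous (fun x => a x i)) (hb : ∀ i, Continuous (fun x => b x i))
    (hne : ∀ x i, a x i ≠ 0 ∨ b x i ≠ 0) :
    Continuous (fun x => FF μ A (a x) (b x)) := by
  rw [continuous_iff_continuousAt]
  intro x0
  refine continuousAt_of_dominated (bound := fun _ => 1)
    (Filter.Eventually.of_forall fun x => (measurable_prod_sg A _ _).aestronglyMeasurable)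
    (Filter.Eventually.of_forall fun x => Filter.Eventually.of_forall (abs_prod_sg_le A _ _))
    (integrable_const _) ?_
  have h : ∀ i, ∀ᵐ y ∂μ, ⟪a x0 i, y⟫ - b x0 i ≠ 0 := by
    intro i
    exact ae_ne hμ _ _ (hne x0 i)
  filter_upwards [ae_all_iff.2 h] with y hy
  refine tendsto_finsetProd _ fun i _ => ?_
  have h1 : ContinuousAt (fun x => ⟪a x i, y⟫ - b x i) x0 := by
    have := ha i
    have := hb i
    fun_prop
  exact ContinuousAt.comp (g := Real.sign) (continuousAt_rsign (hy i)) h1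

lemma FF_flip {d : ℕ} (μ : Measure (EuclideanSpace ℝ (Fin d))) (A : Finset (Fin 4))
    (a a' : Fin 4 → EuclideanSpace ℝ (Fin d)) (b b' : Fin 4 → ℝ) (i : Fin 4)
    (h1 : a' i = - a i) (h2 : b' i = - b i) (h3 : ∀ j, j ≠ i → a' j = a j)
    (h4 : ∀ j, j ≠ i → b' j = b j) :
    FF μ A a' b' = (if i ∈ A then -1 else 1) * FF μ A a b := by
  unfold FF
  rw [← integral_const_mul]
  congr 1
  funext y
  have : ∀ j, sg (a' j) (b' j) y = (if i = j then -1 else 1) * sg (a j) (b j) y := by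
    intro j
    by_cases h : j = i
    · subst h; rw [h1, h2, sg_neg]; simp
    · rw [h3 j h, h4 j h, if_neg (Ne.symm h), one_mul]
  simp only [this, Finset.prod_mul_distrib, Finset.prod_ite_eq]

/-- Sign of a Boolean. -/
def bs (ε : Bool) : ℝ := if ε then 1 else -1

lemma equipart {d : ℕ} (μ : Measure (EuclideanSpace ℝ (Fin d))) [IsFiniteMeasure μ]
    (hμ : μ ≪ volume) (a : Fin 4 → EuclideanSpace ℝ (Fin d)) (b : Fin 4 → ℝ)
    (ha : ∀ i, a i ≠ 0) (s : Finset (Fin 4))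
    (h0 : ∀ A ⊆ s, A.Nonempty → FF μ A a b = 0) (ε : Fin 4 → Bool) :
    μ (region a b s ε) = μ Set.univ / 2 ^ s.card := by
  have hne : ∀ᵐ y ∂μ, ∀ i, ⟪a i, y⟫ - b i ≠ 0 :=
    ae_all_iff.2 fun i => ae_ne hμ _ _ (Or.inl (ha i))
  have hmeas : MeasurableSet (region a b s ε) := by
    unfold region
    refine Finset.measurableSet_biInter _ fun i _ => ?_
    unfold halfSpace
    split_ifs
    · exact (isClosed_le (by fun_prop) (by fun_prop)).measurableSet
    · exact (isClosed_le (by fun_prop) (by fun_prop)).measurableSet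
  have hind : ∀ᵐ y ∂μ, (region a b s ε).indicator (fun _ => (1 : ℝ)) y =
      (1 / 2 ^ s.card) * ∑ A ∈ s.powerset, (∏ i ∈ A, bs (ε i)) * ∏ i ∈ A, sg (a i) (b i) y := by
    filter_upwards [hne] with y hy
    have e1 : ∑ A ∈ s.powerset, (∏ i ∈ A, bs (ε i)) * ∏ i ∈ A, sg (a i) (b i) y =
        ∏ i ∈ s, (1 + bs (ε i) * sg (a i) (b i) y) := by
      rw [Finset.prod_one_add]
      simp only [Finset.prod_mul_distrib]
    have hs : ∀ i, (y ∈ halfSpace (a i) (b i) (ε i) → bs (ε i) * sg (a i) (b i) y = 1) ∧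
        (y ∉ halfSpace (a i) (b i) (ε i) → bs (ε i) * sg (a i) (b i) y = -1) := by
      intro i
      have hyi := hy i
      unfold halfSpace bs sg
      rcases lt_or_gt_of_ne hyi with h | h
      · rw [Real.sign_of_neg h]
        cases ε i <;> refine ⟨fun hm => ?_, fun hm => ?_⟩ <;> simp at hm ⊢ <;> linarith
      · rw [Real.sign_of_pos h]
        cases ε i <;> refine ⟨fun hm => ?_, fun hm => ?_⟩ <;> simp at hm ⊢ <;> linarith
    rw [e1]
    by_cases hin : y ∈ region a b s ε
    · rw [Set.indicator_of_mem hin]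
      have : ∏ i ∈ s, (1 + bs (ε i) * sg (a i) (b i) y) = 2 ^ s.card := by
        rw [← Finset.prod_const]
        refine Finset.prod_congr rfl fun i hi => ?_
        rw [(hs i).1 (Set.mem_iInter₂.1 hin i hi)]; norm_num
      rw [this]
      field_simp
    · rw [Set.indicator_of_notMem hin]
      unfold region at hin
      simp only [Set.mem_iInter, not_forall] at hin
      obtain ⟨i, hi, hni⟩ := hin
      rw [Finset.prod_eq_zero hi, mul_zero]
      rw [(hs i).2 hni]; norm_num
  have hreal : μ.real (region a b s ε) = (1 / 2 ^ s.card) * μ.real Set.univ := by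
    have h1 : ∫ y, (region a b s ε).indicator (fun _ => (1 : ℝ)) y ∂μ = μ.real (region a b s ε) := by
      rw [integral_indicator_const _ hmeas]; simp
    rw [← h1, integral_congr_ae hind, integral_const_mul, integral_finsetSum]
    · congr 1
      rw [Finset.sum_eq_single_of_mem ∅ (by simp)]
      · simp
      · intro A hA hne
        rw [integral_const_mul]
        have := h0 A (Finset.mem_powerset.1 hA) (Finset.nonempty_iff_ne_empty.2 hne)
        unfold FF at this
        rw [this, mul_zero]
    · intro A _
      exact (integrable_prod_sg μ A a b).const_mul _
  rw [← ENNReal.toReal_eq_toReal_iff' (measure_ne_top _ _)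
    (ENNReal.div_ne_top (measure_ne_top _ _) (by positivity))]
  change μ.real (region a b s ε) = _
  rw [hreal, ENNReal.toReal_div]
  simp [Measure.real]
  ring

end Equi

namespace Equi

lemma coeff_count {κ : Type*} [Fintype κ] [DecidableEq κ] (A : κ → Finset (Fin 4))
    (e : Fin 4 →₀ ℕ) :
    MvPolynomial.coeff e (∏ k, lf (A k)) = ∑ σ ∈ Fintype.piFinset A,
      if (∀ i, Fintype.card {k // σ k = i} = e i) then 1 else 0 := by
  unfold lf
  rw [Finset.prod_univ_sum, MvPolynomial.coeff_sum]
  refine Finset.sum_congr rfl fun σ _ => ?_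
  have h : (∏ k, MvPolynomial.X (σ k) : Pol) =
      MvPolynomial.monomial (∑ k, Finsupp.single (σ k) 1) 1 := by
    rw [MvPolynomial.monomial_sum_one]
    rfl
  rw [h, MvPolynomial.coeff_monomial]
  have h2 : (∑ k, Finsupp.single (σ k) 1 = e) ↔ ∀ i, Fintype.card {k // σ k = i} = e i := by
    rw [Finsupp.ext_iff]
    refine forall_congr' fun i => ?_
    rw [Finsupp.finsetSum_apply]
    simp only [Finsupp.single_apply, Finset.sum_boole, Nat.cast_id]
    rw [Fintype.card_subtype]
  simp only [h2]

/-- Types of conditions for the first group of masses. -/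
def S14 : Finset (Finset (Fin 4)) := Finset.univ.filter (fun A => A.Nonempty ∧ A.card ≤ 3)

/-- Types of conditions for the second group of masses. -/
def S6 : Finset (Finset (Fin 4)) := Finset.univ.filter (fun A => A.Nonempty ∧ A.card ≤ 2 ∧ 0 ∉ A)

/-- Ordered pairs. -/
def S2 : Finset (Fin 4 × Fin 4) := Finset.univ.filter (fun p => p.1 < p.2)

lemma prod_S14 : ∏ A ∈ S14, lf A = Tp * Up := by
  have : S14 = [{0}, {0, 1}, {0, 2}, {0, 3}, {0, 1, 2}, {0, 1, 3}, {0, 2, 3}, {1, 2, 3},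
    {1}, {2}, {3}, {1, 2}, {1, 3}, {2, 3}].toFinset := by decide +kernel
  rw [this, List.prod_toFinset _ (by decide +kernel)]
  simp only [List.map_cons, List.map_nil, List.prod_cons, List.prod_nil, Tp, Up]
  ring

lemma prod_S6 : ∏ A ∈ S6, lf A = Up := by
  have : S6 = [{1}, {2}, {3}, {1, 2}, {1, 3}, {2, 3}].toFinset := by decide +kernel
  rw [this, List.prod_toFinset _ (by decide +kernel)]
  simp only [List.map_cons, List.map_nil, List.prod_cons, List.prod_nil, Up]
  ring

lemma prod_S2 : ∏ p ∈ S2, lf {p.1, p.2} =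
    lf {0, 1} * lf {0, 2} * lf {0, 3} * lf {1, 2} * lf {1, 3} * lf {2, 3} := by
  have : S2 = [(0, 1), (0, 2), (0, 3), (1, 2), (1, 3), (2, 3)].toFinset := by decide +kernel
  rw [this, List.prod_toFinset _ (by decide +kernel)]
  simp only [List.map_cons, List.map_nil, List.prod_cons, List.prod_nil]
  ring

/-- Index type of the conditions. -/
abbrev Kap (m n : ℕ) := (Fin m × S14) ⊕ ((Fin n × S6) ⊕ S2)

/-- Types of the conditions. -/
def KA {m n : ℕ} : Kap m n → Finset (Fin 4)
  | .inl p => p.2.1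
  | .inr (.inl p) => p.2.1
  | .inr (.inr p) => {p.1.1, p.1.2}

lemma prod_KA (m n : ℕ) : ∏ k : Kap m n, lf (KA k) = Tp ^ m * Up ^ (m + n) *
    (lf {0, 1} * lf {0, 2} * lf {0, 3} * lf {1, 2} * lf {1, 3} * lf {2, 3}) := by
  rw [Fintype.prod_sum_type, Fintype.prod_sum_type, Fintype.prod_prod_type, Fintype.prod_prod_type]
  simp only [KA]
  rw [Finset.prod_coe_sort S14 (fun A => lf A), Finset.prod_coe_sort S6 (fun A => lf A),
    Finset.prod_coe_sort S2 (fun p => lf {p.1, p.2}), prod_S14, prod_S6, prod_S2]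
  simp only [Finset.prod_const, Finset.card_univ, Fintype.card_fin]
  ring

lemma card_Kap (m n : ℕ) : Fintype.card (Kap m n) = 14 * m + 6 * n + 6 := by
  have h1 : S14.card = 14 := by decide +kernel
  have h2 : S6.card = 6 := by decide +kernel
  have h3 : S2.card = 6 := by decide +kernel
  simp only [Fintype.card_sum, Fintype.card_prod, Fintype.card_fin, Fintype.card_coe, h1, h2, h3]
  ring

/-- Coordinates of the configuration space. -/
abbrev Iot (d : ℕ) := Σ i : Fin 4, Fin (d - i)

/-- Normal vectors. -/
def va {d : ℕ} (x : Iot d → ℝ) (i : Fin 4) : EuclideanSpace ℝ (Fin d) :=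
  WithLp.toLp 2 (fun j : Fin d => if h : (j : ℕ) < d - i then x ⟨i, ⟨j, h⟩⟩ else 0)

/-- Offsets. -/
def vb {d : ℕ} (x : Iot d → ℝ) (i : Fin 4) : ℝ := 1 - ‖fun j : Fin (d - i) => x ⟨i, j⟩‖

lemma continuous_va {d : ℕ} (i : Fin 4) : Continuous (fun x : Iot d → ℝ => va x i) := by
  unfold va
  refine (PiLp.continuous_toLp 2 _).comp (continuous_pi fun j => ?_)
  by_cases h : (j : ℕ) < d - i
  · simp only [h, dite_true]; fun_prop
  · simp only [h, dite_false]; fun_prop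

lemma continuous_vb {d : ℕ} (i : Fin 4) : Continuous (fun x : Iot d → ℝ => vb x i) := by
  unfold vb; fun_prop

lemma vb_of_va {d : ℕ} (x : Iot d → ℝ) (i : Fin 4) (h : va x i = 0) : vb x i = 1 := by
  have : (fun j : Fin (d - i) => x ⟨i, j⟩) = 0 := by
    funext j
    have hj := congrArg (fun v : EuclideanSpace ℝ (Fin d) => v ⟨j, by omega⟩) h
    simpa [va] using hj
  rw [vb, this]; simp

lemma va_or_vb {d : ℕ} (x : Iot d → ℝ) (i : Fin 4) : va x i ≠ 0 ∨ vb x i ≠ 0 := by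
  by_cases h : va x i = 0
  · right; rw [vb_of_va x i h]; norm_num
  · exact Or.inl h

lemma va_flip {d : ℕ} (x : Iot d → ℝ) (i : Fin 4) :
    va (rflip (fun j : Iot d => j.1) i x) i = - va x i := by
  ext j
  simp only [va, rflip, PiLp.neg_apply]
  split_ifs <;> simp

lemma va_flip_ne {d : ℕ} (x : Iot d → ℝ) {i j : Fin 4} (h : j ≠ i) :
    va (rflip (fun j : Iot d => j.1) i x) j = va x j := by
  simp [va, rflip, h]

lemma vb_flip_ne {d : ℕ} (x : Iot d → ℝ) {i j : Fin 4} (h : j ≠ i) :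
    vb (rflip (fun j : Iot d => j.1) i x) j = vb x j := by
  simp [vb, rflip, h]

lemma vb_flip {d : ℕ} (x : Iot d → ℝ) (i : Fin 4) (hx : ∀ j, |x j| ≤ 1)
    (hb : ∃ j : Iot d, j.1 = i ∧ |x j| = 1) :
    vb (rflip (fun j : Iot d => j.1) i x) i = - vb x i := by
  have h1 : ‖fun j : Fin (d - i) => x ⟨i, j⟩‖ = 1 := by
    apply le_antisymm
    · rw [pi_norm_le_iff_of_nonneg zero_le_one]
      exact fun j => hx _
    · obtain ⟨⟨i', j⟩, hj, h⟩ := hb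
      simp only at hj
      subst hj
      rw [← h]
      exact norm_le_pi_norm (fun j : Fin (d - i') => x ⟨i', j⟩) j
  have h2 : (fun j : Fin (d - i) => rflip (fun j : Iot d => j.1) i x ⟨i, j⟩) =
      - (fun j : Fin (d - i) => x ⟨i, j⟩) := by
    funext j
    simp [rflip]
  rw [vb, h2, norm_neg, vb, h1]; norm_num

/-- The test map. -/
def ff {d m n : ℕ} (μ : Fin m → Measure (EuclideanSpace ℝ (Fin d)))
    (ν : Fin n → Measure (EuclideanSpace ℝ (Fin d))) (k : Kap m n) (x : Iot d → ℝ) : ℝ :=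
  match k with
  | .inl p => FF (μ p.1) p.2.1 (va x) (vb x)
  | .inr (.inl p) => FF (ν p.1) p.2.1 (va x) (vb x)
  | .inr (.inr p) => ⟪va x p.1.1, va x p.1.2⟫

lemma exists_config {q d m n : ℕ} (hd : d = 3 * 2 ^ q + 2 * m) (hmn : m + n = 2 * 2 ^ q - 2)
    (h1 : 2 ^ q ≤ m) (h2 : m + 1 < 2 * 2 ^ q)
    (μ : Fin m → Measure (EuclideanSpace ℝ (Fin d)))
    (ν : Fin n → Measure (EuclideanSpace ℝ (Fin d)))
    (hμ : ∀ r, IsFiniteMeasure (μ r)) (hν : ∀ r, IsFiniteMeasure (ν r))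
    (hμ' : ∀ r, μ r ≪ volume) (hν' : ∀ r, ν r ≪ volume) :
    ∃ x : Iot d → ℝ, ∀ k, ff μ ν k x = 0 := by
  have hpos : 1 ≤ 2 ^ q := Nat.one_le_two_pow
  have hblk : ∀ i : Fin 4, Fintype.card {j : Iot d // j.1 = i} = d - i := by
    intro i
    rw [Fintype.card_congr (Equiv.sigmaSubtype i)]
    simp
  obtain ⟨x, -, hx⟩ := exists_zero (κ := Kap m n) (ι := Iot d) (r := 4) (by
      rw [card_Kap, Fintype.card_sigma, Fin.sum_univ_four]
      simp
      omega) (fun j => j.1) KA (ff μ ν) (by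
      rintro (p | p | p)
      · haveI := hμ p.1
        exact continuous_FF _ (hμ' _) _ _ _ continuous_va continuous_vb va_or_vb
      · haveI := hν p.1
        exact continuous_FF _ (hν' _) _ _ _ continuous_va continuous_vb va_or_vb
      · exact (continuous_va _).inner (continuous_va _)) (by
      intro k i x hx hb
      have e1 := va_flip x i
      have e2 := vb_flip x i hx hb
      have e3 : ∀ j, j ≠ i → _ := fun j h => va_flip_ne x (i := i) (j := j) h
      have e4 : ∀ j, j ≠ i → _ := fun j h => vb_flip_ne x (i := i) (j := j) h
      rcases k with p | p | ⟨⟨j, l⟩, hp⟩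
      · exact FF_flip _ _ _ _ _ _ i e1 e2 e3 e4
      · exact FF_flip _ _ _ _ _ _ i e1 e2 e3 e4
      · have hlt : j < l := by simpa [S2] using hp
        simp only [ff, KA, Finset.mem_insert, Finset.mem_singleton]
        by_cases hj : i = j
        · subst hj
          rw [e1, e3 l hlt.ne', inner_neg_left]; simp
        · by_cases hl : i = l
          · subst hl
            rw [e1, e3 j hlt.ne, inner_neg_right]; simp
          · rw [e3 j (Ne.symm hj), e3 l (Ne.symm hl)]; simp [hj, hl]) (by
      set e : Fin 4 →₀ ℕ := Finsupp.equivFunOnFinite.symm (fun i : Fin 4 => d - (i : ℕ))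
      have hcoef := coeff_odd q m h1 h2 e (by simp [e]; omega) (by simp [e]; omega)
        (by simp [e]; omega) (by simp [e]; omega)
      rw [← hmn, ← prod_KA, coeff_count] at hcoef
      simp only [hblk]
      simp only [e, Finsupp.equivFunOnFinite_symm_apply_apply] at hcoef
      rw [hcoef]
      exact one_ne_zero)
  exact ⟨x, hx⟩

lemma FF_singleton_ne {d : ℕ} (μ : Measure (EuclideanSpace ℝ (Fin d))) [IsFiniteMeasure μ]
    (hμ : μ ≠ 0) (x : Iot d → ℝ) (i : Fin 4) (h : FF μ {i} (va x) (vb x) = 0) : va x i ≠ 0 := by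
  intro ha
  have hb := vb_of_va x i ha
  have : ∀ y, sg (va x i) (vb x i) y = -1 := by
    intro y
    rw [ha, hb, sg, Real.sign_of_neg (by simp)]
  simp only [FF, Finset.prod_singleton, this, integral_const, smul_eq_mul, mul_neg, mul_one,
    neg_eq_zero] at h
  rw [measureReal_eq_zero_iff] at h
  exact hμ (Measure.measure_univ_eq_zero.1 h)

open Classical in
/-- Replace the zero measure by something nonzero. -/
def fixm {d : ℕ} (μ : Measure (EuclideanSpace ℝ (Fin d))) : Measure (EuclideanSpace ℝ (Fin d)) :=
  if μ = 0 then volume.restrict (Metric.ball 0 1) else μ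

lemma fixm_ne {d : ℕ} (μ : Measure (EuclideanSpace ℝ (Fin d))) : fixm μ ≠ 0 := by
  unfold fixm
  split_ifs with h
  · rw [Ne, Measure.restrict_eq_zero]
    exact (Metric.measure_ball_pos volume _ one_pos).ne'
  · exact h

lemma fixm_finite {d : ℕ} (μ : Measure (EuclideanSpace ℝ (Fin d))) (h : IsFiniteMeasure μ) :
    IsFiniteMeasure (fixm μ) := by
  unfold fixm
  split_ifs with h
  · exact ⟨by rw [Measure.restrict_apply_univ]; exact measure_ball_lt_top⟩
  · assumption

lemma fixm_ac {d : ℕ} (μ : Measure (EuclideanSpace ℝ (Fin d))) (h : μ ≪ volume) :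
    fixm μ ≪ volume := by
  unfold fixm
  split_ifs with h
  · exact Measure.restrict_le_self.absolutelyContinuous
  · assumption

lemma fixm_equipart {d : ℕ} (μ : Measure (EuclideanSpace ℝ (Fin d))) [IsFiniteMeasure μ]
    (hμ : μ ≪ volume) (a : Fin 4 → EuclideanSpace ℝ (Fin d)) (b : Fin 4 → ℝ)
    (ha : ∀ i, a i ≠ 0) (s : Finset (Fin 4))
    (h0 : ∀ A ⊆ s, A.Nonempty → FF (fixm μ) A a b = 0) (ε : Fin 4 → Bool) :
    μ (region a b s ε) = μ Set.univ / 2 ^ s.card := by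
  by_cases h : μ = 0
  · subst h; simp
  · simp only [fixm, if_neg h] at h0
    exact equipart μ hμ a b ha s h0 ε

end Equi

theorem stmt_9 (q t : ℕ) (hq : 1 ≤ q) (ht1 : 2 ≤ t) (ht2 : t ≤ 2 ^ q)
    (d : ℕ) (hd : d = 7 * 2 ^ q - 2 * t)
    (μ : Fin (2 ^ (q + 1) - 2) → Measure (EuclideanSpace ℝ (Fin d)))
    (hfin : ∀ r, IsFiniteMeasure (μ r))
    (hac : ∀ r, μ r ≪ volume) :
    ∃ (a : Fin 4 → EuclideanSpace ℝ (Fin d)) (b : Fin 4 → ℝ),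
      (∀ i, a i ≠ 0) ∧
      (∀ i j, i ≠ j → ⟪a i, a j⟫ = (0 : ℝ)) ∧
      -- (i) any three of H₁, H₂, H₃, H₄ equipartition the first 2^(q+1) - t masses
      (∀ r : Fin (2 ^ (q + 1) - 2), (r : ℕ) < 2 ^ (q + 1) - t →
        ∀ s : Finset (Fin 4), s.card = 3 → ∀ ε : Fin 4 → Bool,
          μ r (region a b s ε) = μ r Set.univ / 2 ^ 3) ∧
      -- (ii) any two of H₂, H₃, H₄ equipartition the remaining t - 2 masses
      (∀ r : Fin (2 ^ (q + 1) - 2), 2 ^ (q + 1) - t ≤ (r : ℕ) →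
        ∀ s : Finset (Fin 4), s.card = 2 → (0 : Fin 4) ∉ s →
          ∀ ε : Fin 4 → Bool,
            μ r (region a b s ε) = μ r Set.univ / 2 ^ 2) := by
  have hpow : 2 ^ (q + 1) = 2 * 2 ^ q := by ring
  have hpos : 1 ≤ 2 ^ q := Nat.one_le_two_pow
  obtain ⟨x, hx⟩ := Equi.exists_config (q := q) (d := d) (m := 2 ^ (q + 1) - t) (n := t - 2)
    (by omega) (by omega) (by omega) (by omega)
    (fun r => Equi.fixm (μ ⟨r, by omega⟩))
    (fun r => Equi.fixm (μ ⟨2 ^ (q + 1) - t + r, by omega⟩))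
    (fun r => Equi.fixm_finite _ (hfin _)) (fun r => Equi.fixm_finite _ (hfin _))
    (fun r => Equi.fixm_ac _ (hac _)) (fun r => Equi.fixm_ac _ (hac _))
  have hA : ∀ i, Equi.va x i ≠ 0 := by
    intro i
    have h0 : 0 < 2 ^ (q + 1) - 2 := by omega
    haveI := Equi.fixm_finite _ (hfin ⟨0, h0⟩)
    refine Equi.FF_singleton_ne (Equi.fixm (μ ⟨0, h0⟩)) (Equi.fixm_ne _) x i ?_
    exact hx (.inl (⟨0, by omega⟩, ⟨{i}, by simp [Equi.S14]⟩))
  refine ⟨Equi.va x, Equi.vb x, hA, ?_, ?_, ?_⟩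
  · have key : ∀ i j : Fin 4, i < j → ⟪Equi.va x i, Equi.va x j⟫ = (0 : ℝ) := by
      intro i j h
      exact hx (.inr (.inr ⟨(i, j), by simpa [Equi.S2] using h⟩))
    intro i j hij
    rcases lt_or_gt_of_ne hij with h | h
    · exact key i j h
    · rw [real_inner_comm]; exact key j i h
  · intro r hr s hs ε
    haveI := hfin r
    rw [← hs]
    refine Equi.fixm_equipart (μ r) (hac r) _ _ hA s (fun A hAs hne => ?_) ε
    exact hx (.inl (⟨r, hr⟩, ⟨A, by
      simp only [Equi.S14, Finset.mem_filter, Finset.mem_univ, true_and]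
      exact ⟨hne, (Finset.card_le_card hAs).trans hs.le⟩⟩))
  · intro r hr s hs h0 ε
    haveI := hfin r
    rw [← hs]
    refine Equi.fixm_equipart (μ r) (hac r) _ _ hA s (fun A hAs hne => ?_) ε
    have h := hx (.inr (.inl (⟨(r : ℕ) - (2 ^ (q + 1) - t), by omega⟩, ⟨A, by
      simp only [Equi.S6, Finset.mem_filter, Finset.mem_univ, true_and]
      exact ⟨hne, (Finset.card_le_card hAs).trans hs.le, fun h => h0 (hAs h)⟩⟩)))
    have e : (⟨2 ^ (q + 1) - t + ((r : ℕ) - (2 ^ (q + 1) - t)), by omega⟩ :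
        Fin (2 ^ (q + 1) - 2)) = r := Fin.ext (by simp; omega)
    simp only [Equi.ff] at h
    rw [e] at h
    exact h
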